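/- Let d ≥ 1 and n₁,…,n_d ≥ 1, n = n₁+…+n_d. Suppose (f_m) is a sequence in L¹(ℝⁿ) such that ‖S f_m‖_{L¹} ≤ 1 for all m and f_m(x) → f(x) for almost every x ∈ ℝⁿ. Then f ∈ L¹(ℝⁿ) and for every φ ∈ C_c^∞(ℝⁿ) one has ∫_{ℝⁿ} f_m φ dx → ∫_{ℝⁿ} f φ dx. -/

import Mathlib

open MeasureTheory ENNReal Filter

noncomputable section

/-- A dyadic cube in `ℝ^m`, recorded by its generation `k` and its corner index `j`;
it represents the set `∏ i, [j i * 2^k, (j i + 1) * 2^k)`. -/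
structure DyadicCube (m : ℕ) where
  k : ℤ
  j : Fin m → ℤ

/-- The underlying set of a dyadic cube. -/
def dyadicCubeSet {m : ℕ} (c : DyadicCube m) : Set (Fin m → ℝ) :=
  {x | ∀ i, (c.j i : ℝ) * 2 ^ c.k ≤ x i ∧ x i < ((c.j i : ℝ) + 1) * 2 ^ c.k}

/-- The generation-`k` dyadic cube containing the point `x`. -/
def dyadicCubeOf {m : ℕ} (k : ℤ) (x : Fin m → ℝ) : DyadicCube m :=
  ⟨k, fun i => ⌊x i / 2 ^ k⌋⟩

/-- `E_k f x`: the average of `f` over the generation-`k` dyadic cube containing `x`. -/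
def Ek {m : ℕ} (k : ℤ) (f : (Fin m → ℝ) → ℝ) (x : Fin m → ℝ) : ℝ :=
  ⨍ y in dyadicCubeSet (dyadicCubeOf k x), f y

/-- The martingale difference operator `Δ_Q f = (E_{k-1} f - E_k f) · 1_Q`
for a dyadic cube `Q` of generation `k`. -/
def deltaQ {m : ℕ} (c : DyadicCube m) (f : (Fin m → ℝ) → ℝ) : (Fin m → ℝ) → ℝ :=
  (dyadicCubeSet c).indicator (fun y => Ek (c.k - 1) f y - Ek c.k f y)

/-- The product space `ℝ^{n 0} × ⋯ × ℝ^{n (d-1)}`. -/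
abbrev ProductSpace {d : ℕ} (n : Fin d → ℕ) : Type := ∀ i, (Fin (n i) → ℝ)

/-- A dyadic rectangle `R = Q₁ × ⋯ × Q_d`, one dyadic cube in each block. -/
abbrev DyadicRect {d : ℕ} (n : Fin d → ℕ) : Type := ∀ i, DyadicCube (n i)

/-- The underlying set of a dyadic rectangle. -/
def dyadicRectSet {d : ℕ} {n : Fin d → ℕ} (R : DyadicRect n) : Set (ProductSpace n) :=
  {x | ∀ i, x i ∈ dyadicCubeSet (R i)}

/-- Apply the one-parameter operator `Δ_Q` in the `i`-th block of variables. -/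
def deltaBlock {d : ℕ} {n : Fin d → ℕ} (i : Fin d) (c : DyadicCube (n i))
    (f : ProductSpace n → ℝ) (x : ProductSpace n) : ℝ :=
  deltaQ c (fun y => f (Function.update x i y)) (x i)

/-- The multiparameter difference operator `Δ_R = Δ_{Q₁} ⊗ ⋯ ⊗ Δ_{Q_d}`, obtained
by applying `Δ_{Q_i}` in the `i`-th block of variables. -/
def deltaR {d : ℕ} {n : Fin d → ℕ} (R : DyadicRect n) (f : ProductSpace n → ℝ) :
    ProductSpace n → ℝ :=
  (List.finRange d).foldr (fun i g => deltaBlock i (R i) g) f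

/-- The squared `L²` norm `‖g‖_{L²}²`, as an extended nonnegative real. -/
def l2normSq {d : ℕ} {n : Fin d → ℕ} (g : ProductSpace n → ℝ) : ℝ≥0∞ :=
  ∫⁻ x, ENNReal.ofReal (g x ^ 2)

/-- The multiparameter dyadic square function `S f (x) = (∑_R |Δ_R f(x)|²)^{1/2}`. -/
def squareFn {d : ℕ} {n : Fin d → ℕ} (f : ProductSpace n → ℝ) (x : ProductSpace n) : ℝ≥0∞ :=
  (∑' R : DyadicRect n, ENNReal.ofReal (deltaR R f x ^ 2)) ^ (1 / 2 : ℝ)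

/-- The dyadic product `H¹` norm `‖S f‖_{L¹}`. -/
def H1Norm {d : ℕ} {n : Fin d → ℕ} (f : ProductSpace n → ℝ) : ℝ≥0∞ :=
  ∫⁻ x, squareFn f x

/-- An axis-parallel cube in `ℝ^m` with arbitrary corner and (positive) side length. -/
structure Cube (m : ℕ) where
  corner : Fin m → ℝ
  side : ℝ
  side_pos : 0 < side

/-- The underlying set of a cube. -/
def cubeSet {m : ℕ} (c : Cube m) : Set (Fin m → ℝ) :=
  {x | ∀ i, c.corner i ≤ x i ∧ x i < c.corner i + c.side}

/-- A rectangle `R = Q₁ × ⋯ × Q_d`: an axis-parallel cube in each block. -/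
abbrev Rect {d : ℕ} (n : Fin d → ℕ) : Type := ∀ i, Cube (n i)

/-- The underlying set of a rectangle. -/
def rectSet {d : ℕ} {n : Fin d → ℕ} (R : Rect n) : Set (ProductSpace n) :=
  {x | ∀ i, x i ∈ cubeSet (R i)}

/-- The little `bmo` norm: `sup_R |R|⁻¹ ∫_R |f - f_R|` over all rectangles. -/
def bmo1 {d : ℕ} {n : Fin d → ℕ} (f : ProductSpace n → ℝ) : ℝ≥0∞ :=
  ⨆ R : Rect n,
    (volume (rectSet R))⁻¹ * ∫⁻ x in rectSet R, ENNReal.ofReal |f x - ⨍ y in rectSet R, f y|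

/-- The `L²`-based little `bmo` norm: `sup_R (|R|⁻¹ ∫_R |f - f_R|²)^{1/2}` over all
rectangles. -/
def bmo2 {d : ℕ} {n : Fin d → ℕ} (f : ProductSpace n → ℝ) : ℝ≥0∞ :=
  ⨆ R : Rect n,
    ((volume (rectSet R))⁻¹ *
      ∫⁻ x in rectSet R, ENNReal.ofReal ((f x - ⨍ y in rectSet R, f y) ^ 2)) ^ (1 / 2 : ℝ)

/-- The one-parameter `BMO` norm over all axis-parallel cubes in `ℝ^m`. -/
def bmo1Cube {m : ℕ} (g : (Fin m → ℝ) → ℝ) : ℝ≥0∞ :=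
  ⨆ Q : Cube m,
    (volume (cubeSet Q))⁻¹ * ∫⁻ x in cubeSet Q, ENNReal.ofReal |g x - ⨍ y in cubeSet Q, g y|

/-- The `L²`-based one-parameter `BMO` norm over all axis-parallel cubes in `ℝ^m`. -/
def bmo2Cube {m : ℕ} (g : (Fin m → ℝ) → ℝ) : ℝ≥0∞ :=
  ⨆ Q : Cube m,
    ((volume (cubeSet Q))⁻¹ *
      ∫⁻ x in cubeSet Q, ENNReal.ofReal ((g x - ⨍ y in cubeSet Q, g y) ^ 2)) ^ (1 / 2 : ℝ)

/-- The strong maximal function: supremum of averages of `|f|` over all rectangles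
containing the point. -/
def strongMaximal {d : ℕ} {n : Fin d → ℕ} (f : ProductSpace n → ℝ) (x : ProductSpace n) :
    ℝ≥0∞ :=
  ⨆ (R : Rect n) (_ : x ∈ rectSet R),
    (volume (rectSet R))⁻¹ * ∫⁻ y in rectSet R, ENNReal.ofReal |f y|

end

theorem mem_dyadicCubeSet_iff {m : ℕ} {c : DyadicCube m} {x : Fin m → ℝ} :
    x ∈ dyadicCubeSet c ↔ dyadicCubeOf c.k x = c := by
  obtain ⟨k, j⟩ := c
  have hk : (0 : ℝ) < 2 ^ k := by positivity
  simp only [dyadicCubeSet, dyadicCubeOf, Set.mem_ofPred_eq, DyadicCube.mk.injEq, true_and,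
    funext_iff, Int.floor_eq_iff, le_div_iff₀ hk, div_lt_iff₀ hk]

theorem mem_dyadicCubeSet_dyadicCubeOf {m : ℕ} {k : ℤ} {x y : Fin m → ℝ} :
    y ∈ dyadicCubeSet (dyadicCubeOf k x) ↔ dyadicCubeOf k y = dyadicCubeOf k x :=
  mem_dyadicCubeSet_iff

theorem dyadicCubeOf_eq_iff {m : ℕ} {k : ℤ} {x y : Fin m → ℝ} :
    dyadicCubeOf k x = dyadicCubeOf k y ↔ ∀ i, ⌊x i / 2 ^ k⌋ = ⌊y i / 2 ^ k⌋ := by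
  simp [dyadicCubeOf, funext_iff]

theorem dyadicCubeOf_eq_of_le {m : ℕ} {k l : ℤ} (hkl : k ≤ l) {x y : Fin m → ℝ}
    (h : dyadicCubeOf k x = dyadicCubeOf k y) : dyadicCubeOf l x = dyadicCubeOf l y := by
  rw [dyadicCubeOf_eq_iff] at h ⊢
  intro i
  obtain ⟨p, rfl⟩ := Int.le.dest hkl
  have key : ∀ t : ℝ, ⌊t / 2 ^ (k + (p : ℤ))⌋ = ⌊t / 2 ^ k⌋ / ((2 ^ p : ℕ) : ℤ) := by
    intro t
    rw [← Int.floor_div_natCast, zpow_add₀ (by norm_num), ← div_div]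
    norm_num
  rw [key, key, h i]

theorem dyadicCubeSet_eq_pi {m : ℕ} (c : DyadicCube m) :
    dyadicCubeSet c = Set.univ.pi fun i =>
      Set.Ico ((c.j i : ℝ) * 2 ^ c.k) (((c.j i : ℝ) + 1) * 2 ^ c.k) := by
  ext x
  simp [dyadicCubeSet]

theorem measurableSet_dyadicCubeSet {m : ℕ} (c : DyadicCube m) :
    MeasurableSet (dyadicCubeSet c) := by
  rw [dyadicCubeSet_eq_pi]
  exact MeasurableSet.univ_pi fun i => measurableSet_Ico

theorem volume_dyadicCubeSet {m : ℕ} (c : DyadicCube m) :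
    volume (dyadicCubeSet c) = ENNReal.ofReal ((2 ^ c.k) ^ m) := by
  rw [dyadicCubeSet_eq_pi, Real.volume_pi_Ico, ENNReal.ofReal_pow (by positivity)]
  simp [add_mul]

theorem volume_real_dyadicCubeSet {m : ℕ} (c : DyadicCube m) :
    volume.real (dyadicCubeSet c) = (2 ^ c.k) ^ m := by
  rw [Measure.real, volume_dyadicCubeSet, ENNReal.toReal_ofReal (by positivity)]

instance (m : ℕ) : Countable (DyadicCube m) :=
  Function.Injective.countable (f := fun c : DyadicCube m => (c.k, c.j)) (by
    rintro ⟨k, j⟩ ⟨k', j'⟩ h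
    simpa using h)

theorem measurableSet_sameCube (m : ℕ) (k : ℤ) :
    MeasurableSet {p : (Fin m → ℝ) × (Fin m → ℝ) | dyadicCubeOf k p.2 = dyadicCubeOf k p.1} := by
  simp only [dyadicCubeOf_eq_iff, Set.ofPred_forall]
  refine MeasurableSet.iInter fun i => measurableSet_eq_fun ?_ ?_
  · exact Int.measurable_floor.comp (by fun_prop)
  · exact Int.measurable_floor.comp (by fun_prop)

/-- The integral kernel of the averaging operator over cubes of generation `k`. -/
noncomputable def cubeKernel {m : ℕ} (k : ℤ) (x y : Fin m → ℝ) : ℝ :=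
  (dyadicCubeSet (dyadicCubeOf k x)).indicator (fun _ => ((2 ^ k) ^ m)⁻¹) y

open Classical in
theorem cubeKernel_eq_ite {m : ℕ} (k : ℤ) (x y : Fin m → ℝ) :
    cubeKernel k x y = if dyadicCubeOf k y = dyadicCubeOf k x then ((2 ^ k) ^ m)⁻¹ else 0 := by
  by_cases h : dyadicCubeOf k y = dyadicCubeOf k x
  · rw [if_pos h, cubeKernel, Set.indicator_of_mem (mem_dyadicCubeSet_dyadicCubeOf.2 h)]
  · rw [if_neg h, cubeKernel,
      Set.indicator_of_notMem (fun h' => h (mem_dyadicCubeSet_dyadicCubeOf.1 h'))]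

theorem Ek_eq_integral {m : ℕ} (k : ℤ) (f : (Fin m → ℝ) → ℝ) (x : Fin m → ℝ) :
    Ek k f x = ∫ y, cubeKernel k x y * f y := by
  rw [Ek, setAverage_eq, volume_real_dyadicCubeSet, ← integral_indicator
    (measurableSet_dyadicCubeSet _), smul_eq_mul, ← integral_const_mul]
  refine integral_congr_ae (.of_forall fun y => ?_)
  simp only [cubeKernel, Set.indicator]
  split_ifs <;> simp [dyadicCubeOf]

open Classical in
theorem cubeKernel_comm {m : ℕ} (k : ℤ) (x y : Fin m → ℝ) :
    cubeKernel k x y = cubeKernel k y x := by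
  rw [cubeKernel_eq_ite, cubeKernel_eq_ite]
  exact if_congr eq_comm rfl rfl

theorem cubeKernel_nonneg {m : ℕ} (k : ℤ) (x y : Fin m → ℝ) : 0 ≤ cubeKernel k x y :=
  Set.indicator_nonneg (fun _ _ => by positivity) _

theorem cubeKernel_le {m : ℕ} (k : ℤ) (x y : Fin m → ℝ) :
    cubeKernel k x y ≤ ((2 ^ k) ^ m)⁻¹ :=
  Set.indicator_le_self' (fun _ _ => by positivity) _

theorem cubeKernel_congr {m : ℕ} {k : ℤ} {x x' : Fin m → ℝ}
    (h : dyadicCubeOf k x = dyadicCubeOf k x') (y : Fin m → ℝ) :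
    cubeKernel k x y = cubeKernel k x' y := by
  rw [cubeKernel, cubeKernel, h]

theorem cubeKernel_sub_one_le {m : ℕ} (k : ℤ) (x y : Fin m → ℝ) :
    cubeKernel (k - 1) x y ≤ 2 ^ m * cubeKernel k x y := by
  simp only [cubeKernel_eq_ite]
  by_cases h : dyadicCubeOf (k - 1) y = dyadicCubeOf (k - 1) x
  · rw [if_pos h, if_pos (dyadicCubeOf_eq_of_le (by lia) h), ← inv_pow, ← inv_pow, ← mul_pow,
      zpow_sub_one₀ (by norm_num)]
    simp
  · rw [if_neg h]
    split_ifs <;> positivity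

theorem measurable_cubeKernel (m : ℕ) (k : ℤ) :
    Measurable (fun p : (Fin m → ℝ) × (Fin m → ℝ) => cubeKernel k p.1 p.2) := by
  have : (fun p : (Fin m → ℝ) × (Fin m → ℝ) => cubeKernel k p.1 p.2) =
      {p : (Fin m → ℝ) × (Fin m → ℝ) | dyadicCubeOf k p.2 = dyadicCubeOf k p.1}.indicator
        (fun _ => ((2 ^ k) ^ m)⁻¹) := by
    ext p
    simp [cubeKernel_eq_ite, Set.indicator]
  rw [this]
  exact measurable_const.indicator (measurableSet_sameCube m k)

theorem integrable_cubeKernel {m : ℕ} (k : ℤ) (x : Fin m → ℝ) :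
    Integrable (cubeKernel k x) := by
  refine (integrable_indicator_iff (measurableSet_dyadicCubeSet _)).2 ?_
  refine integrableOn_const ?_
  rw [volume_dyadicCubeSet]
  exact ofReal_ne_top

theorem integral_cubeKernel {m : ℕ} (k : ℤ) (x : Fin m → ℝ) : ∫ y, cubeKernel k x y = 1 := by
  unfold cubeKernel
  rw [integral_indicator (measurableSet_dyadicCubeSet _), setIntegral_const,
    volume_real_dyadicCubeSet, smul_eq_mul]
  exact mul_inv_cancel₀ (by positivity)

/-- A function which is measurable and bounded. -/
structure BddMeas {α : Type*} [MeasurableSpace α] (H : α → ℝ) : Prop where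
  measurable : Measurable H
  bdd : ∃ M, ∀ x, |H x| ≤ M

namespace BddMeas

variable {α : Type*} [MeasurableSpace α] {G H : α → ℝ} {μ : Measure α}

theorem const (c : ℝ) : BddMeas (fun _ : α => c) := ⟨measurable_const, |c|, fun _ => le_rfl⟩

theorem add (hG : BddMeas G) (hH : BddMeas H) : BddMeas (fun x => G x + H x) := by
  obtain ⟨M, hM⟩ := hG.bdd
  obtain ⟨N, hN⟩ := hH.bdd
  exact ⟨hG.measurable.add hH.measurable, M + N, fun x =>
    (abs_add_le _ _).trans (add_le_add (hM x) (hN x))⟩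

theorem neg (hG : BddMeas G) : BddMeas (fun x => -G x) :=
  ⟨hG.measurable.neg, by simpa using hG.bdd⟩

theorem sub (hG : BddMeas G) (hH : BddMeas H) : BddMeas (fun x => G x - H x) := by
  simpa only [sub_eq_add_neg] using hG.add hH.neg

theorem mul (hG : BddMeas G) (hH : BddMeas H) : BddMeas (fun x => G x * H x) := by
  obtain ⟨M, hM⟩ := hG.bdd
  obtain ⟨N, hN⟩ := hH.bdd
  refine ⟨hG.measurable.mul hH.measurable, M * N, fun x => ?_⟩
  rw [abs_mul]
  exact mul_le_mul (hM x) (hN x) (abs_nonneg _) ((abs_nonneg _).trans (hM x))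

theorem sum {ι : Type*} (s : Finset ι) {F : ι → α → ℝ} (h : ∀ i ∈ s, BddMeas (F i)) :
    BddMeas (fun x => ∑ i ∈ s, F i x) := by
  classical
  induction s using Finset.induction_on with
  | empty => simpa using const (α := α) 0
  | insert a s ha ih =>
    simp only [Finset.sum_insert ha]
    exact (h a (Finset.mem_insert_self a s)).add
      (ih fun i hi => h i (Finset.mem_insert_of_mem hi))

theorem indicator (hG : BddMeas G) {s : Set α} (hs : MeasurableSet s) :
    BddMeas (s.indicator G) := by
  obtain ⟨M, hM⟩ := hG.bdd
  refine ⟨hG.measurable.indicator hs, M, fun x => ?_⟩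
  by_cases h : x ∈ s
  · simpa [h] using hM x
  · simpa [h] using (abs_nonneg _).trans (hM x)

theorem comp {β : Type*} [MeasurableSpace β] (hG : BddMeas G) {g : β → α} (hg : Measurable g) :
    BddMeas (fun x => G (g x)) :=
  ⟨hG.measurable.comp hg, hG.bdd.imp fun _ h x => h (g x)⟩

theorem integrable_mul (hH : BddMeas H) (hG : Integrable G μ) :
    Integrable (fun x => H x * G x) μ := by
  obtain ⟨M, hM⟩ := hH.bdd
  exact hG.bdd_mul hH.measurable.aestronglyMeasurable (.of_forall hM)

theorem mul_integrable (hH : BddMeas H) (hG : Integrable G μ) :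
    Integrable (fun x => G x * H x) μ := by
  simpa only [mul_comm] using hH.integrable_mul hG

end BddMeas

theorem bddMeas_indicator_one {α : Type*} [MeasurableSpace α] {s : Set α} (hs : MeasurableSet s) :
    BddMeas (s.indicator (fun _ => (1 : ℝ))) :=
  (BddMeas.const 1).indicator hs

section Block

variable {d : ℕ} {n : Fin d → ℕ}

/-- The generation-`k` averaging operator in the `i`-th block of variables. -/
noncomputable def blockAvg (i : Fin d) (k : ℤ) (G : ProductSpace n → ℝ) (x : ProductSpace n) : ℝ :=
  Ek k (fun y => G (Function.update x i y)) (x i)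

/-- `G` is constant, in the `i`-th block of variables, on cubes of generation `k`. -/
def BlockInv (i : Fin d) (k : ℤ) (G : ProductSpace n → ℝ) : Prop :=
  ∀ x y, dyadicCubeOf k y = dyadicCubeOf k (x i) → G (Function.update x i y) = G x

theorem blockAvg_eq_integral (i : Fin d) (k : ℤ) (G : ProductSpace n → ℝ) (x : ProductSpace n) :
    blockAvg i k G x = ∫ y, cubeKernel k (x i) y * G (Function.update x i y) :=
  Ek_eq_integral _ _ _

theorem deltaBlock_eq_indicator (i : Fin d) (c : DyadicCube (n i)) (G : ProductSpace n → ℝ)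
    (x : ProductSpace n) :
    deltaBlock i c G x = (dyadicCubeSet c).indicator
      (fun _ => blockAvg i (c.k - 1) G x - blockAvg i c.k G x) (x i) := by
  unfold deltaBlock deltaQ blockAvg
  simp only [Set.indicator]

/-- Exchange the `i`-th block of the first component with the second component. -/
def blockSwap (i : Fin d) (p : ProductSpace n × (Fin (n i) → ℝ)) :
    ProductSpace n × (Fin (n i) → ℝ) :=
  (Function.update p.1 i p.2, p.1 i)

theorem measurePreserving_exchange {X A B : Type*} [MeasurableSpace X] [MeasurableSpace A]
    [MeasurableSpace B] {μ : Measure X} {α : Measure A} {β : Measure B} [SFinite μ] [SFinite α]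
    [SFinite β] (e : X ≃ᵐ A × B) (he : MeasurePreserving e μ (α.prod β)) :
    MeasurePreserving (fun p : X × A => (e.symm (p.2, (e p.1).2), (e p.1).1))
      (μ.prod α) (μ.prod α) := by
  have h1 := he.prod (MeasurePreserving.id α)
  have h2 := ((MeasurePreserving.id α).prod
    (Measure.measurePreserving_swap (μ := α) (ν := β))).comp
    (Measure.measurePreserving_swap (μ := α.prod β) (ν := α))
  exact ((he.symm _).prod (MeasurePreserving.id α)).comp
    (((measurePreserving_prodAssoc α β α).symm _).comp
      (((MeasurePreserving.id α).prod Measure.measurePreserving_swap).comp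
        (Measure.measurePreserving_swap.comp h1)))

theorem measurePreserving_blockSwap (i : Fin d) :
    MeasurePreserving (blockSwap (n := n) i) (volume.prod volume) (volume.prod volume) := by
  obtain ⟨d, rfl⟩ : ∃ d', d = d' + 1 := ⟨d - 1, by have := i.2; omega⟩
  have h := measurePreserving_exchange
    (MeasurableEquiv.piFinSuccAbove (fun i => (Fin (n i) → ℝ)) i)
    (volume_preserving_piFinSuccAbove (fun i => (Fin (n i) → ℝ)) i)
  have hf : blockSwap (n := n) i = fun p =>
      ((MeasurableEquiv.piFinSuccAbove (fun i => (Fin (n i) → ℝ)) i).symm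
        (p.2, (MeasurableEquiv.piFinSuccAbove (fun i => (Fin (n i) → ℝ)) i p.1).2),
        (MeasurableEquiv.piFinSuccAbove (fun i => (Fin (n i) → ℝ)) i p.1).1) := by
    funext p
    refine Prod.ext ?_ rfl
    simp [blockSwap, MeasurableEquiv.piFinSuccAbove, Fin.insertNthEquiv]
  rw [hf]
  exact h

end Block

section Block

variable {d : ℕ} {n : Fin d → ℕ} {i j : Fin d} {k l : ℤ} {G H : ProductSpace n → ℝ}

theorem BlockInv.mono (h : BlockInv i l G) (hkl : k ≤ l) : BlockInv i k G :=
  fun x y hxy => h x y (dyadicCubeOf_eq_of_le hkl hxy)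

theorem BlockInv.mul (hG : BlockInv i k G) (hH : BlockInv i k H) :
    BlockInv i k (fun x => G x * H x) :=
  fun x y hxy => by simp only [hG x y hxy, hH x y hxy]

theorem blockAvg_eq_self (h : BlockInv i k G) : blockAvg i k G = G := by
  funext x
  have : ∀ y, cubeKernel k (x i) y * G (Function.update x i y) = cubeKernel k (x i) y * G x := by
    intro y
    rw [cubeKernel_eq_ite]
    split_ifs with hy
    · rw [h x y hy]
    · simp
  simp only [blockAvg_eq_integral, this]
  rw [integral_mul_const, integral_cubeKernel, one_mul]

theorem blockInv_blockAvg : BlockInv i k (blockAvg i k G) := by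
  intro x y hxy
  simp only [blockAvg_eq_integral, Function.update_self, Function.update_idem,
    cubeKernel_congr hxy]

theorem BlockInv.blockAvg_of_ne (hij : j ≠ i) (h : BlockInv j l G) :
    BlockInv j l (blockAvg i k G) := by
  intro x y hxy
  simp only [blockAvg_eq_integral, Function.update_of_ne hij.symm]
  congr 1
  funext z
  rw [Function.update_comm hij]
  congr 1
  exact h _ _ (by rwa [Function.update_of_ne hij])

theorem BlockInv.deltaBlock_of_ne (hij : j ≠ i) (c : DyadicCube (n i)) (h : BlockInv j l G) :
    BlockInv j l (deltaBlock i c G) := by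
  intro x y hxy
  simp only [deltaBlock_eq_indicator, Function.update_of_ne hij.symm,
    h.blockAvg_of_ne hij x y hxy]

theorem blockInv_indicator_cube (c : DyadicCube (n i)) (hk : k ≤ c.k) (r : ℝ) :
    BlockInv i k (fun x => (dyadicCubeSet c).indicator (fun _ => r) (x i)) := by
  classical
  intro x y hxy
  simp only [Set.indicator, mem_dyadicCubeSet_iff, Function.update_self,
    dyadicCubeOf_eq_of_le hk hxy]

theorem deltaBlock_eq_mul (c : DyadicCube (n i)) (x : ProductSpace n) :
    deltaBlock i c G x = (dyadicCubeSet c).indicator (fun _ => 1) (x i) *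
      (blockAvg i (c.k - 1) G x - blockAvg i c.k G x) := by
  rw [deltaBlock_eq_indicator]
  by_cases h : x i ∈ dyadicCubeSet c <;> simp [h]

theorem blockInv_deltaBlock (c : DyadicCube (n i)) :
    BlockInv i (c.k - 1) (deltaBlock i c G) := by
  intro x y hxy
  have h1 := blockInv_indicator_cube c (k := c.k - 1) (by lia) 1 x y hxy
  have h2 := blockInv_blockAvg (G := G) x y hxy
  have h3 := (blockInv_blockAvg (i := i) (k := c.k) (G := G)).mono
    (k := c.k - 1) (by lia) x y hxy
  simp only [deltaBlock_eq_mul, h1, h2, h3]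

theorem deltaBlock_eq_zero (c : DyadicCube (n i)) (h : BlockInv i c.k G) :
    deltaBlock i c G = 0 := by
  funext x
  rw [deltaBlock_eq_mul, blockAvg_eq_self h, blockAvg_eq_self (h.mono (by lia))]
  simp

theorem measurable_update_pair (i : Fin d) :
    Measurable (fun p : ProductSpace n × (Fin (n i) → ℝ) => Function.update p.1 i p.2) := by
  refine measurable_pi_lambda _ fun j => ?_
  by_cases h : j = i
  · subst h
    simpa using measurable_snd
  · simp only [Function.update_of_ne h]
    fun_prop

theorem measurable_cubeKernel_block (i : Fin d) (k : ℤ) :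
    Measurable (fun p : ProductSpace n × (Fin (n i) → ℝ) => cubeKernel k (p.1 i) p.2) := by
  have h : Measurable (fun p : ProductSpace n × (Fin (n i) → ℝ) => (p.1 i, p.2)) :=
    ((measurable_pi_apply i).comp measurable_fst).prodMk measurable_snd
  have h' := (measurable_cubeKernel (n i) k).comp h
  simpa only [Function.comp_def] using h'

theorem measurable_update_block (i : Fin d) (x : ProductSpace n) :
    Measurable (fun y : Fin (n i) → ℝ => Function.update x i y) :=
  (measurable_update_pair i).comp (by fun_prop : Measurable fun y => (x, y))

theorem BddMeas.integrable_cubeKernel_mul (hH : BddMeas H) (x : ProductSpace n) (i : Fin d)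
    (k : ℤ) : Integrable (fun y => cubeKernel k (x i) y * H (Function.update x i y)) :=
  (hH.comp (measurable_update_block i x)).mul_integrable (integrable_cubeKernel _ _)

theorem abs_blockAvg_le {M : ℝ} (hH : BddMeas H) (hM : ∀ x, |H x| ≤ M) (x : ProductSpace n) :
    |blockAvg i k H x| ≤ M := by
  rw [blockAvg_eq_integral]
  calc |∫ y, cubeKernel k (x i) y * H (Function.update x i y)|
      ≤ ∫ y, |cubeKernel k (x i) y * H (Function.update x i y)| := abs_integral_le_integral_abs
    _ ≤ ∫ y, cubeKernel k (x i) y * M := by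
        refine integral_mono (hH.integrable_cubeKernel_mul x i k).abs
          ((integrable_cubeKernel _ _).mul_const M) fun y => ?_
        simp only [abs_mul, abs_of_nonneg (cubeKernel_nonneg k (x i) y)]
        exact mul_le_mul_of_nonneg_left (hM _) (cubeKernel_nonneg _ _ _)
    _ = M := by rw [integral_mul_const, integral_cubeKernel, one_mul]

theorem BddMeas.blockAvg (hH : BddMeas H) (i : Fin d) (k : ℤ) : BddMeas (blockAvg i k H) := by
  obtain ⟨M, hM⟩ := hH.bdd
  refine ⟨?_, M, abs_blockAvg_le hH hM⟩
  have : Measurable (fun p : ProductSpace n × (Fin (n i) → ℝ) =>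
      cubeKernel k (p.1 i) p.2 * H (Function.update p.1 i p.2)) :=
    (measurable_cubeKernel_block i k).mul (hH.measurable.comp (measurable_update_pair i))
  have h2 := this.stronglyMeasurable.integral_prod_right' (ν := volume)
  convert h2.measurable using 1
  funext x
  exact blockAvg_eq_integral _ _ _ _

theorem blockAvg_mono (hG : BddMeas G) (hH : BddMeas H) (h : ∀ x, G x ≤ H x)
    (x : ProductSpace n) : blockAvg i k G x ≤ blockAvg i k H x := by
  simp only [blockAvg_eq_integral]
  exact integral_mono (hG.integrable_cubeKernel_mul x i k) (hH.integrable_cubeKernel_mul x i k)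
    fun y => mul_le_mul_of_nonneg_left (h _) (cubeKernel_nonneg _ _ _)

theorem blockAvg_nonneg (h : ∀ x, 0 ≤ H x) (x : ProductSpace n) : 0 ≤ blockAvg i k H x := by
  rw [blockAvg_eq_integral]
  exact integral_nonneg fun y => mul_nonneg (cubeKernel_nonneg _ _ _) (h _)

theorem blockAvg_const_mul (r : ℝ) (x : ProductSpace n) :
    blockAvg i k (fun y => r * H y) x = r * blockAvg i k H x := by
  simp only [blockAvg_eq_integral, ← integral_const_mul]
  congr 1
  funext y
  ring

theorem blockAvg_add (hG : BddMeas G) (hH : BddMeas H) (x : ProductSpace n) :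
    blockAvg i k (fun y => G y + H y) x = blockAvg i k G x + blockAvg i k H x := by
  simp only [blockAvg_eq_integral, mul_add]
  exact integral_add (hG.integrable_cubeKernel_mul x i k) (hH.integrable_cubeKernel_mul x i k)

theorem blockAvg_const (r : ℝ) (x : ProductSpace n) :
    blockAvg i k (fun _ => r) x = r := by
  rw [blockAvg_eq_self (fun _ _ _ => rfl)]

theorem blockAvg_sub_one_le (hH : BddMeas H) (h : ∀ x, 0 ≤ H x) (x : ProductSpace n) :
    blockAvg i (k - 1) H x ≤ 2 ^ n i * blockAvg i k H x := by
  simp only [blockAvg_eq_integral, ← integral_const_mul, ← mul_assoc]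
  refine integral_mono (hH.integrable_cubeKernel_mul x i _) ?_
    fun y => mul_le_mul_of_nonneg_right (cubeKernel_sub_one_le _ _ _) (h _)
  simpa only [mul_assoc] using (hH.integrable_cubeKernel_mul x i k).const_mul _

/-- Block averages commute with multiplication by invariant functions. -/
theorem blockAvg_mul_left (hG : BlockInv i k G) (x : ProductSpace n) :
    blockAvg i k (fun y => G y * H y) x = G x * blockAvg i k H x := by
  simp only [blockAvg_eq_integral, ← integral_const_mul]
  congr 1
  funext y
  rw [cubeKernel_eq_ite]
  split_ifs with hy
  · rw [hG x y hy]; ring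
  · simp

theorem integrable_cubeKernel_block (hG : Integrable G) (i : Fin d) (k : ℤ) :
    Integrable (fun p : ProductSpace n × (Fin (n i) → ℝ) => cubeKernel k (p.1 i) p.2 * G p.1)
      (volume.prod volume) := by
  have hm : AEStronglyMeasurable (fun p : ProductSpace n × (Fin (n i) → ℝ) =>
      cubeKernel k (p.1 i) p.2 * G p.1) (volume.prod volume) :=
    (measurable_cubeKernel_block i k).aestronglyMeasurable.mul
      hG.aestronglyMeasurable.comp_fst
  rw [integrable_prod_iff hm]
  refine ⟨.of_forall fun x => (integrable_cubeKernel k (x i)).mul_const (G x), ?_⟩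
  have : ∀ x : ProductSpace n, ∫ y, ‖cubeKernel k (x i) y * G x‖ = ‖G x‖ := by
    intro x
    simp only [norm_mul, Real.norm_of_nonneg (cubeKernel_nonneg _ _ _)]
    rw [integral_mul_const, integral_cubeKernel, one_mul]
  simpa only [this] using hG.norm

theorem integrable_cubeKernel_update (hG : Integrable G) (i : Fin d) (k : ℤ) :
    Integrable (fun p : ProductSpace n × (Fin (n i) → ℝ) =>
      cubeKernel k (p.1 i) p.2 * G (Function.update p.1 i p.2)) (volume.prod volume) := by
  have h := (measurePreserving_blockSwap (n := n) i).integrable_comp_of_integrable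
    (integrable_cubeKernel_block hG i k)
  convert h using 2 with p
  simp [blockSwap, cubeKernel_comm k p.2]

theorem MeasureTheory.Integrable.blockAvg (hG : Integrable G) (i : Fin d) (k : ℤ) :
    Integrable (blockAvg i k G) := by
  have := (integrable_cubeKernel_update hG i k).integral_prod_left
  convert this using 1
  funext x
  exact blockAvg_eq_integral _ _ _ _

theorem integral_blockAvg_mul (hG : Integrable G) (hH : BddMeas H) :
    ∫ x, blockAvg i k G x * H x = ∫ x, G x * blockAvg i k H x := by
  have hHp : BddMeas (fun p : ProductSpace n × (Fin (n i) → ℝ) =>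
    H (Function.update p.1 i p.2)) := hH.comp (measurable_update_pair i)
  have hHf : BddMeas (fun p : ProductSpace n × (Fin (n i) → ℝ) => H p.1) :=
    hH.comp measurable_fst
  have h1 := hHp.mul_integrable (integrable_cubeKernel_block hG i k)
  have h2 := hHf.mul_integrable (integrable_cubeKernel_update hG i k)
  have hs := measurePreserving_blockSwap (n := n) i
  have e1 : ∫ x, blockAvg i k G x * H x = ∫ p : ProductSpace n × (Fin (n i) → ℝ),
      cubeKernel k (p.1 i) p.2 * G (Function.update p.1 i p.2) * H p.1 ∂(volume.prod volume) := by
    rw [integral_prod _ h2]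
    congr 1
    funext x
    rw [blockAvg_eq_integral, ← integral_mul_const]
  have e2 : ∫ x, G x * blockAvg i k H x = ∫ p : ProductSpace n × (Fin (n i) → ℝ),
      cubeKernel k (p.1 i) p.2 * G p.1 * H (Function.update p.1 i p.2)
        ∂(volume.prod volume) := by
    rw [integral_prod _ h1]
    congr 1
    funext x
    rw [blockAvg_eq_integral, ← integral_const_mul]
    congr 1
    funext y
    ring
  rw [e1, e2]
  conv_rhs => rw [← hs.map_eq]
  rw [integral_map hs.aemeasurable (by rw [hs.map_eq]; exact h1.aestronglyMeasurable)]
  congr 1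
  funext p
  simp [blockSwap, cubeKernel_comm k p.2]

theorem bddMeas_indicator_cube (c : DyadicCube (n i)) :
    BddMeas (fun x : ProductSpace n => (dyadicCubeSet c).indicator (fun _ => (1 : ℝ)) (x i)) :=
  (bddMeas_indicator_one (measurableSet_dyadicCubeSet c)).comp (by fun_prop)

theorem MeasureTheory.Integrable.deltaBlock (hG : Integrable G) (c : DyadicCube (n i)) :
    Integrable (deltaBlock i c G) := by
  rw [funext (deltaBlock_eq_mul c)]
  exact (bddMeas_indicator_cube c).integrable_mul
    ((hG.blockAvg i (c.k - 1)).sub (hG.blockAvg i c.k))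

theorem BddMeas.deltaBlock (hH : BddMeas H) (c : DyadicCube (n i)) :
    BddMeas (deltaBlock i c H) := by
  rw [funext (deltaBlock_eq_mul c)]
  exact (bddMeas_indicator_cube c).mul ((hH.blockAvg i (c.k - 1)).sub (hH.blockAvg i c.k))

theorem integral_deltaBlock_mul (hG : Integrable G) (hH : BddMeas H) (c : DyadicCube (n i)) :
    ∫ x, deltaBlock i c G x * H x = ∫ x, G x * deltaBlock i c H x := by
  set χ : ProductSpace n → ℝ := fun x => (dyadicCubeSet c).indicator (fun _ => 1) (x i) with hχ
  have hχb : BddMeas χ := bddMeas_indicator_cube c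
  have hχH : BddMeas (fun x => χ x * H x) := hχb.mul hH
  have key : ∀ l ≤ c.k, ∀ x, blockAvg i l (fun y => χ y * H y) x = χ x * blockAvg i l H x :=
    fun l hl x => blockAvg_mul_left (blockInv_indicator_cube c hl 1) x
  have e1 : ∀ x, deltaBlock i c G x * H x =
      blockAvg i (c.k - 1) G x * (χ x * H x) - blockAvg i c.k G x * (χ x * H x) := by
    intro x
    rw [deltaBlock_eq_mul]
    ring
  have e2 : ∀ x, G x * deltaBlock i c H x =
      G x * blockAvg i (c.k - 1) (fun y => χ y * H y) x
        - G x * blockAvg i c.k (fun y => χ y * H y) x := by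
    intro x
    rw [deltaBlock_eq_mul, key _ (by lia), key _ le_rfl]
    ring
  simp only [e1, e2]
  rw [integral_sub (hχH.mul_integrable (hG.blockAvg _ _))
      (hχH.mul_integrable (hG.blockAvg _ _)),
    integral_sub ((hχH.blockAvg _ _).mul_integrable hG)
      ((hχH.blockAvg _ _).mul_integrable hG),
    integral_blockAvg_mul hG hχH, integral_blockAvg_mul hG hχH]

end Block

section DeltaList

variable {d : ℕ} {n : Fin d → ℕ} {i j : Fin d} {k : Fin d → ℤ} {G H f : ProductSpace n → ℝ}
  {R R' : DyadicRect n}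

/-- Apply the operators `Δ_{R i}` successively in the blocks `i` of the list `l`. -/
noncomputable def deltaList (l : List (Fin d)) (R : DyadicRect n) (f : ProductSpace n → ℝ) :
    ProductSpace n → ℝ :=
  l.foldr (fun i g => deltaBlock i (R i) g) f

theorem deltaList_cons (i : Fin d) (l : List (Fin d)) (R : DyadicRect n)
    (f : ProductSpace n → ℝ) :
    deltaList (i :: l) R f = deltaBlock i (R i) (deltaList l R f) := rfl

theorem deltaR_eq_deltaList (R : DyadicRect n) (f : ProductSpace n → ℝ) :
    deltaR R f = deltaList (List.finRange d) R f := rfl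

theorem deltaBlock_eq_zero_of_ne {s : Set (Fin (n i) → ℝ)} (hij : i ≠ j) (c : DyadicCube (n j))
    (hG : ∀ x, x i ∉ s → G x = 0) {x : ProductSpace n} (hx : x i ∉ s) :
    deltaBlock j c G x = 0 := by
  have (l : ℤ) : blockAvg j l G x = 0 := by
    rw [blockAvg_eq_integral]
    refine integral_eq_zero_of_ae (.of_forall fun y => ?_)
    simp [hG (Function.update x j y) (by rwa [Function.update_of_ne hij])]
  simp [deltaBlock_eq_mul, this]

theorem deltaList_eq_zero {l : List (Fin d)} (hi : i ∈ l) {x : ProductSpace n}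
    (hx : x i ∉ dyadicCubeSet (R i)) : deltaList l R f x = 0 := by
  induction l generalizing x with
  | nil => simp at hi
  | cons j l ih =>
    rw [deltaList_cons]
    by_cases hij : i = j
    · subst hij
      simp [deltaBlock_eq_mul, hx]
    · exact deltaBlock_eq_zero_of_ne hij _
        (fun y hy => ih ((List.mem_cons.1 hi).resolve_left hij) hy) hx

theorem blockInv_deltaList {l : List (Fin d)} (hi : i ∈ l) :
    BlockInv i ((R i).k - 1) (deltaList l R f) := by
  induction l with
  | nil => simp at hi
  | cons j l ih =>
    rw [deltaList_cons]
    by_cases hij : i = j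
    · subst hij
      exact blockInv_deltaBlock _
    · exact (ih ((List.mem_cons.1 hi).resolve_left hij)).deltaBlock_of_ne hij _

theorem MeasureTheory.Integrable.deltaList (hf : Integrable f) (l : List (Fin d)) :
    Integrable (deltaList l R f) := by
  induction l with
  | nil => exact hf
  | cons j l ih => exact ih.deltaBlock _

theorem integral_deltaList_mul_eq_zero {l : List (Fin d)} (hi : i ∈ l) (hf : Integrable f)
    (hH : BddMeas H) (hHi : BlockInv i (R i).k H) : ∫ x, deltaList l R f x * H x = 0 := by
  induction l generalizing H with
  | nil => simp at hi
  | cons j l ih =>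
    rw [deltaList_cons, integral_deltaBlock_mul (hf.deltaList l) hH]
    by_cases hij : i = j
    · subst hij
      simp [deltaBlock_eq_zero _ hHi]
    · exact ih ((List.mem_cons.1 hi).resolve_left hij) (hH.deltaBlock _)
        (hHi.deltaBlock_of_ne hij _)

/-- A function which is invariant in every block only depends on the dyadic cubes containing the
blocks of its argument. -/
theorem eq_of_blockInv (h : ∀ i, BlockInv i (k i) G) {x y : ProductSpace n}
    (hxy : ∀ i, dyadicCubeOf (k i) (y i) = dyadicCubeOf (k i) (x i)) : G y = G x := by
  classical
  have key : ∀ s : Finset (Fin d), G (s.piecewise y x) = G x := by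
    intro s
    induction s using Finset.induction_on with
    | empty => simp
    | insert a s ha ih =>
      rw [Finset.piecewise_insert, h a, ih]
      rw [Finset.piecewise_eq_of_notMem _ _ _ ha]
      exact hxy a
  simpa using key Finset.univ

theorem mem_dyadicRectSet_iff {x : ProductSpace n} :
    x ∈ dyadicRectSet R ↔ ∀ i, dyadicCubeOf (R i).k (x i) = R i := by
  simp only [dyadicRectSet, Set.mem_ofPred_eq, mem_dyadicCubeSet_iff]

theorem dyadicRectSet_eq_pi (R : DyadicRect n) :
    dyadicRectSet R = Set.univ.pi fun i => dyadicCubeSet (R i) := by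
  ext x
  simp [dyadicRectSet]

theorem measurableSet_dyadicRectSet (R : DyadicRect n) : MeasurableSet (dyadicRectSet R) := by
  rw [dyadicRectSet_eq_pi]
  exact MeasurableSet.univ_pi fun i => measurableSet_dyadicCubeSet _

theorem volume_dyadicRectSet (R : DyadicRect n) :
    volume (dyadicRectSet R) = ENNReal.ofReal (∏ i, (2 ^ (R i).k) ^ n i) := by
  rw [dyadicRectSet_eq_pi, volume_pi_pi, ENNReal.ofReal_prod_of_nonneg fun i _ => by positivity]
  simp only [volume_dyadicCubeSet]

theorem volume_real_dyadicRectSet (R : DyadicRect n) :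
    volume.real (dyadicRectSet R) = ∏ i, (2 ^ (R i).k) ^ n i := by
  rw [Measure.real, volume_dyadicRectSet, ENNReal.toReal_ofReal (by positivity)]

theorem measurable_of_blockInv (h : ∀ i, BlockInv i (k i) G) : Measurable G := by
  intro A _
  have : G ⁻¹' A = ⋃ (R : DyadicRect n) (_ : dyadicRectSet R ⊆ G ⁻¹' A), dyadicRectSet R := by
    refine Set.Subset.antisymm (fun x hx => ?_) (Set.iUnion₂_subset fun R hR => hR)
    refine Set.mem_iUnion₂.2 ⟨fun i => dyadicCubeOf (k i) (x i), fun y hy => ?_, ?_⟩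
    · rw [mem_dyadicRectSet_iff] at hy
      rw [Set.mem_preimage, eq_of_blockInv h hy]
      exact hx
    · rw [mem_dyadicRectSet_iff]
      exact fun i => rfl
  rw [this]
  exact MeasurableSet.iUnion fun R => MeasurableSet.iUnion fun _ => measurableSet_dyadicRectSet R

theorem bddMeas_of_blockInv (h : ∀ i, BlockInv i (k i) G) (hG : Integrable G) : BddMeas G := by
  refine ⟨measurable_of_blockInv h, (∫ x, |G x|) / ∏ i, (2 ^ k i) ^ n i, fun x => ?_⟩
  rw [le_div_iff₀ (by positivity)]
  let R : DyadicRect n := fun i => dyadicCubeOf (k i) (x i)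
  have hR : ∀ y ∈ dyadicRectSet R, |G y| = |G x| := fun y hy => by
    rw [eq_of_blockInv h (mem_dyadicRectSet_iff.1 hy)]
  calc |G x| * ∏ i, (2 ^ k i) ^ n i = ∫ y in dyadicRectSet R, |G y| := by
        rw [setIntegral_congr_fun (measurableSet_dyadicRectSet R) hR, setIntegral_const,
          volume_real_dyadicRectSet, smul_eq_mul, mul_comm]
        rfl
    _ ≤ ∫ y, |G y| := setIntegral_le_integral hG.abs (.of_forall fun y => abs_nonneg _)

/-- A step function adapted to the dyadic rectangle `R`, with cancellation in each block. -/
structure IsHaar (R : DyadicRect n) (h : ProductSpace n → ℝ) : Prop where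
  integrable : Integrable h
  blockInv : ∀ i, BlockInv i ((R i).k - 1) h
  eq_zero : ∀ x, x ∉ dyadicRectSet R → h x = 0
  integral_mul : ∀ i H, BddMeas H → BlockInv i (R i).k H → ∫ x, h x * H x = 0

theorem isHaar_deltaR (hf : Integrable f) (R : DyadicRect n) : IsHaar R (deltaR R f) where
  integrable := hf.deltaList _
  blockInv i := blockInv_deltaList (List.mem_finRange i)
  eq_zero x hx := by
    simp only [dyadicRectSet, Set.mem_ofPred_eq, not_forall] at hx
    obtain ⟨i, hi⟩ := hx
    exact deltaList_eq_zero (List.mem_finRange i) hi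
  integral_mul i H hH hHi := integral_deltaList_mul_eq_zero (List.mem_finRange i) hf hH hHi

theorem IsHaar.bddMeas (h : IsHaar R G) : BddMeas G := bddMeas_of_blockInv h.blockInv h.integrable

theorem IsHaar.integral_mul_eq_zero (hG : IsHaar R G) (hH : IsHaar R' H) (hR : R ≠ R') :
    ∫ x, G x * H x = 0 := by
  obtain ⟨i, hi⟩ := Function.ne_iff.1 hR
  rcases lt_trichotomy (R i).k (R' i).k with h | h | h
  · exact hG.integral_mul i H hH.bddMeas ((hH.blockInv i).mono (by lia))
  · refine integral_eq_zero_of_ae (.of_forall fun x => ?_)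
    by_cases hx : x ∈ dyadicRectSet R
    · by_cases hx' : x ∈ dyadicRectSet R'
      · rw [mem_dyadicRectSet_iff] at hx hx'
        exact absurd ((hx i).symm.trans (h ▸ hx' i)) hi
      · simp [hH.eq_zero x hx']
    · simp [hG.eq_zero x hx]
  · simp only [mul_comm (G _)]
    exact hH.integral_mul i G hG.bddMeas ((hG.blockInv i).mono (by lia))

end DeltaList

section Enlargement

variable {d : ℕ} {n : Fin d → ℕ} {i j : Fin d} {k : Fin d → ℤ} {G H : ProductSpace n → ℝ}
  {U V : Set (ProductSpace n)} {θ : ℝ}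

/-- Apply the averaging operators of generations `k i` in the blocks `i` of the list `l`. -/
noncomputable def avgList (l : List (Fin d)) (k : Fin d → ℤ) (H : ProductSpace n → ℝ) :
    ProductSpace n → ℝ :=
  l.foldr (fun i g => blockAvg i (k i) g) H

theorem avgList_cons (i : Fin d) (l : List (Fin d)) (k : Fin d → ℤ) (H : ProductSpace n → ℝ) :
    avgList (i :: l) k H = blockAvg i (k i) (avgList l k H) := rfl

theorem BddMeas.avgList (hH : BddMeas H) (l : List (Fin d)) (k : Fin d → ℤ) :
    BddMeas (avgList l k H) := by
  induction l with
  | nil => exact hH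
  | cons i l ih => exact ih.blockAvg _ _

theorem avgList_nonneg (hH : ∀ x, 0 ≤ H x) (l : List (Fin d)) (k : Fin d → ℤ)
    (x : ProductSpace n) : 0 ≤ avgList l k H x := by
  induction l generalizing x with
  | nil => exact hH x
  | cons i l ih => exact blockAvg_nonneg ih x

theorem abs_avgList_le {M : ℝ} (hH : BddMeas H) (hM : ∀ x, |H x| ≤ M) (l : List (Fin d))
    (k : Fin d → ℤ) (x : ProductSpace n) : |avgList l k H x| ≤ M := by
  induction l generalizing x with
  | nil => exact hM x
  | cons i l ih => exact abs_blockAvg_le (hH.avgList l k) ih x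

theorem blockInv_avgList {l : List (Fin d)} (hi : i ∈ l) : BlockInv i (k i) (avgList l k H) := by
  induction l with
  | nil => simp at hi
  | cons j l ih =>
    rw [avgList_cons]
    by_cases hij : i = j
    · subst hij
      exact blockInv_blockAvg
    · exact (ih ((List.mem_cons.1 hi).resolve_left hij)).blockAvg_of_ne hij

theorem integral_mul_avgList {l : List (Fin d)} (hG : Integrable G)
    (hGi : ∀ i ∈ l, BlockInv i (k i) G) (hH : BddMeas H) :
    ∫ x, G x * avgList l k H x = ∫ x, G x * H x := by
  induction l with
  | nil => rfl
  | cons i l ih =>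
    rw [avgList_cons, ← integral_blockAvg_mul hG (hH.avgList l k),
      blockAvg_eq_self (hGi i List.mem_cons_self),
      ih fun j hj => hGi j (List.mem_cons_of_mem _ hj)]

theorem avgList_sub_one_le (hH : BddMeas H) (h : ∀ x, 0 ≤ H x) (l : List (Fin d))
    (k : Fin d → ℤ) (x : ProductSpace n) :
    avgList l (fun i => k i - 1) H x ≤ 2 ^ (l.map n).sum * avgList l k H x := by
  induction l generalizing x with
  | nil => simp [avgList]
  | cons i l ih =>
    simp only [avgList_cons, List.map_cons, List.sum_cons]
    calc blockAvg i (k i - 1) (avgList l (fun i => k i - 1) H) x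
        ≤ 2 ^ n i * blockAvg i (k i) (avgList l (fun i => k i - 1) H) x :=
          blockAvg_sub_one_le (hH.avgList _ _) (avgList_nonneg h _ _) x
      _ ≤ 2 ^ n i * blockAvg i (k i) (fun y => 2 ^ (l.map n).sum * avgList l k H y) x := by
          gcongr
          exact blockAvg_mono (hH.avgList _ _) ((BddMeas.const _).mul (hH.avgList _ _)) ih x
      _ = 2 ^ (n i + (l.map n).sum) * blockAvg i (k i) (avgList l k H) x := by
          rw [blockAvg_const_mul]
          ring

/-- The set where some average of `1_U` over a cube, with generation in `K`, in the `i`-th block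
exceeds `θ`. -/
def enlarge (i : Fin d) (K : Finset ℤ) (θ : ℝ) (U : Set (ProductSpace n)) :
    Set (ProductSpace n) :=
  {x | ∃ k ∈ K, θ < blockAvg i k (U.indicator fun _ => 1) x}

/-- Enlarge a set successively in the blocks of the list `l`. -/
def enlargeList (l : List (Fin d)) (K : Finset ℤ) (θ : ℝ) (U : Set (ProductSpace n)) :
    Set (ProductSpace n) :=
  l.foldr (fun i V => enlarge i K θ V) U

theorem measurableSet_enlarge (hU : MeasurableSet U) (i : Fin d) (K : Finset ℤ) (θ : ℝ) :
    MeasurableSet (enlarge i K θ U) := by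
  have : enlarge i K θ U = ⋃ k ∈ K, {x | θ < blockAvg i k (U.indicator fun _ => 1) x} := by
    ext x
    simp [enlarge]
  rw [this]
  exact K.measurableSet_biUnion fun k _ => measurableSet_lt measurable_const
    ((bddMeas_indicator_one hU).blockAvg i k).measurable

theorem measurableSet_enlargeList (hU : MeasurableSet U) (l : List (Fin d)) (K : Finset ℤ)
    (θ : ℝ) : MeasurableSet (enlargeList l K θ U) := by
  induction l with
  | nil => exact hU
  | cons i l ih => exact measurableSet_enlarge ih i K θ

theorem enlarge_mono (hU : MeasurableSet U) (hV : MeasurableSet V) (h : U ⊆ V) (i : Fin d)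
    (K : Finset ℤ) (θ : ℝ) : enlarge i K θ U ⊆ enlarge i K θ V := by
  rintro x ⟨k, hk, hx⟩
  exact ⟨k, hk, hx.trans_le (blockAvg_mono (bddMeas_indicator_one hU) (bddMeas_indicator_one hV)
    (fun y => Set.indicator_le_indicator_of_subset h (fun _ => zero_le_one) y) x)⟩

theorem enlargeList_mono (hU : MeasurableSet U) (hV : MeasurableSet V) (h : U ⊆ V)
    (l : List (Fin d)) (K : Finset ℤ) (θ : ℝ) : enlargeList l K θ U ⊆ enlargeList l K θ V := by
  induction l with
  | nil => exact h
  | cons i l ih =>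
    exact enlarge_mono (measurableSet_enlargeList hU l K θ) (measurableSet_enlargeList hV l K θ)
      ih i K θ

theorem enlarge_empty (hθ : 0 ≤ θ) (i : Fin d) (K : Finset ℤ) :
    enlarge (n := n) i K θ ∅ = ∅ := by
  refine Set.eq_empty_of_forall_notMem ?_
  rintro x ⟨k, -, hx⟩
  rw [Set.indicator_empty, blockAvg_const] at hx
  exact hx.not_ge hθ

theorem enlargeList_empty (hθ : 0 ≤ θ) (l : List (Fin d)) (K : Finset ℤ) :
    enlargeList (n := n) l K θ ∅ = ∅ := by
  induction l with
  | nil => rfl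
  | cons i l ih =>
    change enlarge i K θ (enlargeList l K θ ∅) = ∅
    rw [ih, enlarge_empty hθ]

theorem volume_le_of_subset_blockAvg (hθ : 0 < θ) (hU : MeasurableSet U) (hUf : volume U ≠ ∞)
    (hV : MeasurableSet V) {k : ℤ} (hVi : BlockInv i k (V.indicator fun _ => (1 : ℝ)))
    (h : ∀ x ∈ V, θ < blockAvg i k (U.indicator fun _ => 1) x) :
    volume V ≠ ∞ ∧ θ * volume.real V ≤ volume.real (U ∩ V) := by
  have hUi : Integrable (U.indicator fun _ => (1 : ℝ)) :=
    (integrable_indicator_iff hU).2 (integrableOn_const hUf)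
  have hVf : volume V ≠ ∞ := by
    refine ((measure_mono fun x hx => ?_).trans_lt
      ((hUi.blockAvg i k).measure_norm_ge_lt_top hθ)).ne
    exact (h x hx).le.trans (le_abs_self _)
  refine ⟨hVf, ?_⟩
  have hVint : Integrable (V.indicator fun _ => (1 : ℝ)) :=
    (integrable_indicator_iff hV).2 (integrableOn_const hVf)
  calc θ * volume.real V = ∫ x, θ * V.indicator (fun _ => (1 : ℝ)) x := by
        rw [integral_const_mul, integral_indicator hV, setIntegral_const]
        simp
    _ ≤ ∫ x, blockAvg i k (U.indicator fun _ => 1) x * V.indicator (fun _ => (1 : ℝ)) x := by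
        refine integral_mono (hVint.const_mul θ)
          ((bddMeas_indicator_one hV).mul_integrable (hUi.blockAvg i k)) fun x => ?_
        by_cases hx : x ∈ V
        · simpa [hx] using (h x hx).le
        · simp [hx]
    _ = ∫ x, U.indicator (fun _ => 1) x * V.indicator (fun _ => (1 : ℝ)) x := by
        rw [integral_blockAvg_mul hUi (bddMeas_indicator_one hV), blockAvg_eq_self hVi]
    _ = volume.real (U ∩ V) := by
        have : ∀ x, U.indicator (fun _ => 1) x * V.indicator (fun _ => (1 : ℝ)) x =
            (U ∩ V).indicator 1 x := fun x => by
          by_cases hx : x ∈ U <;> by_cases hx' : x ∈ V <;> simp [hx, hx']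
        simp only [this]
        rw [integral_indicator_one (hU.inter hV)]

theorem blockInv_indicator_one {k : ℤ}
    (h : ∀ x y, dyadicCubeOf k y = dyadicCubeOf k (x i) → (Function.update x i y ∈ V ↔ x ∈ V)) :
    BlockInv i k (V.indicator fun _ => (1 : ℝ)) := by
  classical
  intro x y hxy
  simp only [Set.indicator, h x y hxy]

theorem volume_enlarge_le (hθ : 0 < θ) (hU : MeasurableSet U) (hUf : volume U ≠ ∞) (i : Fin d)
    (K : Finset ℤ) : volume (enlarge i K θ U) ≠ ∞ ∧
      θ * volume.real (enlarge i K θ U) ≤ volume.real (U ∩ enlarge i K θ U) := by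
  induction K using Finset.induction_on_min with
  | empty => simp [enlarge]
  | insert k K hk ih =>
    obtain ⟨ihf, ih⟩ := ih
    set E := enlarge i K θ U with hE
    have hEm : MeasurableSet E := measurableSet_enlarge hU i K θ
    set V := {x | θ < blockAvg i k (U.indicator fun _ => 1) x} \ E with hV
    have hVm : MeasurableSet V := (measurableSet_lt measurable_const
      ((bddMeas_indicator_one hU).blockAvg i k).measurable).diff hEm
    have hunion : enlarge i (insert k K) θ U = E ∪ V := by
      rw [hV, Set.union_sdiff_self]
      ext x
      simp [hE, enlarge, or_comm]
    have hdisj : Disjoint E V := Set.disjoint_sdiff_right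
    have hVi : BlockInv i k (V.indicator fun _ => (1 : ℝ)) := by
      refine blockInv_indicator_one fun x y hxy => ?_
      have h1 : Function.update x i y ∈ E ↔ x ∈ E := by
        simp only [hE, enlarge, Set.mem_ofPred_eq]
        refine exists_congr fun l => and_congr_right fun hl => ?_
        rw [(blockInv_blockAvg (i := i) (k := l)).mono (hk l hl).le x y hxy]
      have h2 := blockInv_blockAvg (i := i) (k := k) (G := U.indicator fun _ => 1) x y hxy
      simp only [hV, Set.mem_sdiff, Set.mem_ofPred_eq, h1, h2]
    obtain ⟨hVf, hVle⟩ := volume_le_of_subset_blockAvg hθ hU hUf hVm hVi fun x hx => hx.1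
    rw [hunion]
    refine ⟨(measure_union_lt_top ihf.lt_top hVf.lt_top).ne, ?_⟩
    rw [measureReal_union hdisj hVm ihf hVf, Set.inter_union_distrib_left,
      measureReal_union (hdisj.mono Set.inter_subset_right Set.inter_subset_right)
        (hU.inter hVm) (measure_ne_top_of_subset Set.inter_subset_right ihf)
        (measure_ne_top_of_subset Set.inter_subset_right hVf), mul_add]
    exact add_le_add ih hVle

theorem volume_enlargeList_le (hθ : 0 < θ) (hU : MeasurableSet U) (hUf : volume U ≠ ∞)
    (l : List (Fin d)) (K : Finset ℤ) : volume (enlargeList l K θ U) ≠ ∞ ∧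
      volume.real (enlargeList l K θ U) ≤ (θ⁻¹) ^ l.length * volume.real U := by
  induction l with
  | nil => simpa [enlargeList] using hUf
  | cons i l ih =>
    obtain ⟨h1, h2⟩ := volume_enlarge_le hθ (measurableSet_enlargeList hU l K θ) ih.1 i K
    refine ⟨h1, ?_⟩
    change volume.real (enlarge i K θ (enlargeList l K θ U)) ≤ _
    have h3 := h2.trans (measureReal_mono Set.inter_subset_left ih.1)
    rw [← le_div_iff₀' hθ, div_eq_inv_mul] at h3
    calc _ ≤ _ := h3
      _ ≤ θ⁻¹ * ((θ⁻¹) ^ l.length * volume.real U) := by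
        gcongr
        exact ih.2
      _ = _ := by rw [List.length_cons, pow_succ]; ring

theorem avgList_le_of_notMem_enlargeList (hθ : 0 ≤ θ) (hU : MeasurableSet U) {K : Finset ℤ}
    (l : List (Fin d)) (hk : ∀ i, k i ∈ K) {x : ProductSpace n} (hx : x ∉ enlargeList l K θ U) :
    avgList l k (U.indicator fun _ => 1) x ≤ l.length * θ := by
  induction l generalizing x with
  | nil =>
    change x ∉ U at hx
    simp [avgList, hx]
  | cons i l ih =>
    set V := enlargeList l K θ U with hV
    have hVm : MeasurableSet V := measurableSet_enlargeList hU l K θ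
    have hxV : blockAvg i (k i) (V.indicator fun _ => 1) x ≤ θ :=
      not_lt.1 fun h => hx ⟨k i, hk i, h⟩
    have hUb := (bddMeas_indicator_one hU).avgList l k
    have hVb := bddMeas_indicator_one hVm
    have key : ∀ y, avgList l k (U.indicator fun _ => 1) y ≤
        V.indicator (fun _ => 1) y + l.length * θ := by
      intro y
      by_cases hy : y ∈ V
      · have := (le_abs_self _).trans (abs_avgList_le (M := 1) (bddMeas_indicator_one hU)
          (fun z => by by_cases hz : z ∈ U <;> simp [hz]) l k y)
        simp only [hy, Set.indicator_of_mem]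
        have : 0 ≤ l.length * θ := by positivity
        linarith
      · simpa [hy] using ih hy
    rw [avgList_cons]
    calc _ ≤ blockAvg i (k i) (fun y => V.indicator (fun _ => 1) y + l.length * θ) x :=
          blockAvg_mono hUb (hVb.add (BddMeas.const _)) key x
      _ ≤ θ + l.length * θ := by
          rw [blockAvg_add hVb (BddMeas.const _), blockAvg_const]
          gcongr
      _ = (i :: l).length * θ := by
          push_cast [List.length_cons]
          ring

end Enlargement

section Truncation

variable {d : ℕ} {n : Fin d → ℕ} {s : Finset (DyadicRect n)}
  {h : DyadicRect n → ProductSpace n → ℝ} {t : ℝ}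

/-- The threshold used to enlarge the level sets of square functions. -/
noncomputable def enlargeThreshold (n : Fin d → ℕ) : ℝ := (2 ^ (∑ i, n i) * (2 * (d + 1)))⁻¹

theorem enlargeThreshold_pos (n : Fin d → ℕ) : 0 < enlargeThreshold n := by
  unfold enlargeThreshold
  positivity

theorem two_pow_mul_enlargeThreshold_le (n : Fin d → ℕ) :
    2 ^ (∑ i, n i) * (d * enlargeThreshold n) ≤ 1 / 2 := by
  unfold enlargeThreshold
  rw [mul_inv, mul_left_comm, ← mul_assoc _ (2 ^ _)⁻¹, mul_inv_cancel₀ (by positivity), one_mul,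
    ← div_eq_mul_inv, div_le_iff₀ (by positivity)]
  linarith

/-- The square function of a finite family of functions. -/
noncomputable def finSquare (s : Finset (DyadicRect n)) (h : DyadicRect n → ProductSpace n → ℝ)
    (x : ProductSpace n) : ℝ :=
  √(∑ R ∈ s, h R x ^ 2)

/-- The enlarged level set of the square function at height `t`. -/
noncomputable def bigSet (s : Finset (DyadicRect n)) (h : DyadicRect n → ProductSpace n → ℝ)
    (t : ℝ) : Set (ProductSpace n) :=
  enlargeList (List.finRange d) (s.biUnion fun R => Finset.univ.image fun i => (R i).k)
    (enlargeThreshold n) {x | t < finSquare s h x}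

open Classical in
/-- The sum over the rectangles that are not contained in the enlarged level set. -/
noncomputable def goodPart (s : Finset (DyadicRect n)) (h : DyadicRect n → ProductSpace n → ℝ)
    (t : ℝ) (x : ProductSpace n) : ℝ :=
  ∑ R ∈ s with ¬ dyadicRectSet R ⊆ bigSet s h t, h R x

/-- The truncated square function `min t (S² / t)`. -/
noncomputable def truncSquare (s : Finset (DyadicRect n))
    (h : DyadicRect n → ProductSpace n → ℝ) (t : ℝ) (x : ProductSpace n) : ℝ :=
  min t (finSquare s h x ^ 2 / t)

theorem finSquare_nonneg (x : ProductSpace n) : 0 ≤ finSquare s h x := Real.sqrt_nonneg _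

theorem finSquare_sq (x : ProductSpace n) : finSquare s h x ^ 2 = ∑ R ∈ s, h R x ^ 2 :=
  Real.sq_sqrt (Finset.sum_nonneg fun _ _ => sq_nonneg _)

theorem finSquare_le_sum (x : ProductSpace n) : finSquare s h x ≤ ∑ R ∈ s, |h R x| := by
  refine Real.sqrt_le_iff.2 ⟨Finset.sum_nonneg fun _ _ => abs_nonneg _, ?_⟩
  simpa only [sq_abs] using Finset.sum_sq_le_sq_sum_of_nonneg (s := s)
    (f := fun R => |h R x|) fun _ _ => abs_nonneg _

theorem bddMeas_finSquare (hh : ∀ R, IsHaar R (h R)) : BddMeas (finSquare s h) := by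
  obtain ⟨M, hM⟩ := (BddMeas.sum s fun R _ => (hh R).bddMeas.mul (hh R).bddMeas).bdd
  refine ⟨(Finset.measurable_fun_sum s fun R _ => (hh R).bddMeas.measurable.pow_const 2).sqrt,
    √M, fun x => ?_⟩
  rw [abs_of_nonneg (finSquare_nonneg x)]
  refine Real.sqrt_le_sqrt ((le_abs_self _).trans ?_)
  simpa only [sq] using hM x

theorem integrable_finSquare (hh : ∀ R, IsHaar R (h R)) : Integrable (finSquare s h) := by
  refine Integrable.mono' (integrable_finsetSum s fun R _ => (hh R).integrable.abs)
    (bddMeas_finSquare hh).measurable.aestronglyMeasurable (.of_forall fun x => ?_)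
  rw [Real.norm_of_nonneg (finSquare_nonneg x)]
  exact finSquare_le_sum x

theorem truncSquare_nonneg (ht : 0 ≤ t) (x : ProductSpace n) : 0 ≤ truncSquare s h t x :=
  le_min ht (by positivity)

theorem truncSquare_le (ht : 0 < t) (x : ProductSpace n) :
    truncSquare s h t x ≤ finSquare s h x := by
  rcases le_total t (finSquare s h x) with h' | h'
  · exact (min_le_left _ _).trans h'
  · refine (min_le_right _ _).trans ?_
    rw [div_le_iff₀ ht, sq]
    exact mul_le_mul_of_nonneg_left h' (finSquare_nonneg x)

theorem measurable_truncSquare (hh : ∀ R, IsHaar R (h R)) :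
    Measurable (truncSquare s h t) :=
  measurable_const.min (((bddMeas_finSquare hh).measurable.pow_const 2).div_const t)

theorem integrable_truncSquare (hh : ∀ R, IsHaar R (h R)) (ht : 0 < t) :
    Integrable (truncSquare s h t) := by
  refine Integrable.mono' (integrable_finSquare (s := s) hh)
    (measurable_truncSquare hh).aestronglyMeasurable (.of_forall fun x => ?_)
  rw [Real.norm_of_nonneg (truncSquare_nonneg ht.le x)]
  exact truncSquare_le ht x

theorem measurableSet_level (hh : ∀ R, IsHaar R (h R)) (t : ℝ) :
    MeasurableSet {x | t < finSquare s h x} :=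
  measurableSet_lt measurable_const (bddMeas_finSquare hh).measurable

theorem volume_level_ne_top (hh : ∀ R, IsHaar R (h R)) (ht : 0 < t) :
    volume {x | t < finSquare s h x} ≠ ∞ := by
  refine ((measure_mono fun x hx => ?_).trans_lt
    ((integrable_finSquare (s := s) hh).measure_norm_ge_lt_top ht)).ne
  exact (show t < finSquare s h x from hx).le.trans (le_abs_self _)

theorem measurableSet_bigSet (hh : ∀ R, IsHaar R (h R)) (t : ℝ) :
    MeasurableSet (bigSet s h t) :=
  measurableSet_enlargeList (measurableSet_level hh t) _ _ _

theorem bigSet_anti (hh : ∀ R, IsHaar R (h R)) {t' : ℝ} (htt : t ≤ t') :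
    bigSet s h t' ⊆ bigSet s h t :=
  enlargeList_mono (measurableSet_level hh _) (measurableSet_level hh _)
    (fun _ hx => htt.trans_lt hx) _ _ _

/-- Constant in the bound for the measure of the enlarged level sets. -/
noncomputable def enlargeConst (n : Fin d → ℕ) : ℝ := (enlargeThreshold n)⁻¹ ^ d

theorem enlargeConst_nonneg (n : Fin d → ℕ) : 0 ≤ enlargeConst n :=
  pow_nonneg (inv_nonneg.2 (enlargeThreshold_pos n).le) _

theorem volume_bigSet_ne_top (hh : ∀ R, IsHaar R (h R)) (ht : 0 < t) :
    volume (bigSet s h t) ≠ ∞ :=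
  (volume_enlargeList_le (enlargeThreshold_pos n) (measurableSet_level hh t)
    (volume_level_ne_top hh ht) _ _).1

theorem mul_volume_bigSet_le (hh : ∀ R, IsHaar R (h R)) (ht : 0 < t) :
    t * volume.real (bigSet s h t) ≤ enlargeConst n * ∫ x, truncSquare s h t x := by
  have h1 := (volume_enlargeList_le (enlargeThreshold_pos n) (measurableSet_level (s := s) hh t)
    (volume_level_ne_top hh ht) (List.finRange d)
    (s.biUnion fun R => Finset.univ.image fun i => (R i).k)).2
  rw [List.length_finRange] at h1
  have h2 : t * volume.real {x | t < finSquare s h x} ≤ ∫ x, truncSquare s h t x := by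
    have : t * volume.real {x | t < finSquare s h x} =
        ∫ x in {x | t < finSquare s h x}, truncSquare s h t x := by
      rw [setIntegral_congr_fun (g := fun _ => t) (measurableSet_level hh t) fun x hx => ?_,
        setIntegral_const, smul_eq_mul, mul_comm]
      refine min_eq_left ?_
      rw [le_div_iff₀ ht, sq]
      exact mul_self_le_mul_self ht.le (show t < finSquare s h x from hx).le
    rw [this]
    exact setIntegral_le_integral (integrable_truncSquare hh ht)
      (.of_forall fun x => truncSquare_nonneg ht.le x)
  calc t * volume.real (bigSet s h t)
      ≤ t * (enlargeConst n * volume.real {x | t < finSquare s h x}) :=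
        mul_le_mul_of_nonneg_left h1 ht.le
    _ = enlargeConst n * (t * volume.real {x | t < finSquare s h x}) := by ring
    _ ≤ _ := mul_le_mul_of_nonneg_left h2 (enlargeConst_nonneg n)

theorem goodPart_eq {x : ProductSpace n} (hh : ∀ R, IsHaar R (h R)) (hx : x ∉ bigSet s h t) :
    goodPart s h t x = ∑ R ∈ s, h R x := by
  classical
  unfold goodPart
  rw [Finset.sum_filter]
  refine Finset.sum_congr rfl fun R _ => ?_
  split_ifs with hR
  · exact ((hh R).eq_zero x fun hxR => hx (hR hxR)).symm
  · rfl

theorem bddMeas_goodPart (hh : ∀ R, IsHaar R (h R)) (t : ℝ) : BddMeas (goodPart s h t) :=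
  BddMeas.sum _ fun R _ => (hh R).bddMeas

theorem integrable_goodPart (hh : ∀ R, IsHaar R (h R)) (t : ℝ) : Integrable (goodPart s h t) :=
  integrable_finsetSum _ fun R _ => (hh R).integrable

theorem integral_sum_sq (hh : ∀ R, IsHaar R (h R)) (s : Finset (DyadicRect n)) :
    ∫ x, (∑ R ∈ s, h R x) ^ 2 = ∑ R ∈ s, ∫ x, h R x ^ 2 := by
  have hint : ∀ R R', Integrable fun x => h R x * h R' x := fun R R' =>
    (hh R).bddMeas.integrable_mul (hh R').integrable
  simp only [sq, Finset.sum_mul_sum]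
  rw [integral_finsetSum _ fun R _ => integrable_finsetSum _ fun R' _ => hint R R']
  refine Finset.sum_congr rfl fun R hR => ?_
  rw [integral_finsetSum _ fun R' _ => hint R R']
  exact Finset.sum_eq_single_of_mem R hR fun R' _ hne =>
    (hh R).integral_mul_eq_zero (hh R') hne.symm

theorem integral_sq_indicator_level_le (hh : ∀ R, IsHaar R (h R)) {R : DyadicRect n} (hRs : R ∈ s)
    (hR : ¬ dyadicRectSet R ⊆ bigSet s h t) :
    ∫ x, h R x ^ 2 * {x | t < finSquare s h x}.indicator (fun _ => 1) x ≤
      1 / 2 * ∫ x, h R x ^ 2 := by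
  set U := {x | t < finSquare s h x} with hU
  have hUm : MeasurableSet U := measurableSet_level hh t
  have hUb := bddMeas_indicator_one hUm
  have hsq : Integrable fun x => h R x ^ 2 := by
    simpa only [sq] using (hh R).bddMeas.integrable_mul (hh R).integrable
  obtain ⟨x₀, hx₀R, hx₀⟩ := Set.not_subset.1 hR
  have havg := avgList_le_of_notMem_enlargeList (k := fun i => (R i).k)
    (enlargeThreshold_pos n).le hUm (List.finRange d) (fun i => Finset.mem_biUnion.2
      ⟨R, hRs, Finset.mem_image.2 ⟨i, Finset.mem_univ i, rfl⟩⟩) hx₀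
  rw [List.length_finRange] at havg
  rw [← integral_mul_avgList (k := fun i => (R i).k - 1) (l := List.finRange d) hsq
    (fun i _ => by simpa only [sq] using ((hh R).blockInv i).mul ((hh R).blockInv i)) hUb,
    ← integral_const_mul]
  refine integral_mono ((hUb.avgList _ _).mul_integrable hsq) (hsq.const_mul _) fun x => ?_
  by_cases hx : x ∈ dyadicRectSet R
  · simp only
    rw [mul_comm]
    refine mul_le_mul_of_nonneg_right ?_ (sq_nonneg _)
    have hsum : ((List.finRange d).map n).sum = ∑ i, n i := (Fin.sum_univ_def n).symm
    calc _ ≤ 2 ^ (∑ i, n i) *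
          avgList (List.finRange d) (fun i => (R i).k) (U.indicator fun _ => 1) x := by
          rw [← hsum]
          exact avgList_sub_one_le hUb
            (fun y => Set.indicator_nonneg (fun _ _ => zero_le_one) y) _ _ x
      _ = 2 ^ (∑ i, n i) *
          avgList (List.finRange d) (fun i => (R i).k) (U.indicator fun _ => 1) x₀ := by
          rw [eq_of_blockInv (fun i => blockInv_avgList (List.mem_finRange i)) fun i => ?_]
          rw [mem_dyadicRectSet_iff] at hx hx₀R
          rw [hx i, hx₀R i]
      _ ≤ 2 ^ (∑ i, n i) * (d * enlargeThreshold n) := by gcongr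
      _ ≤ 1 / 2 := two_pow_mul_enlargeThreshold_le n
  · simp [(hh R).eq_zero x hx]

theorem integral_goodPart_sq_le (hh : ∀ R, IsHaar R (h R)) (ht : 0 < t) :
    ∫ x, goodPart s h t x ^ 2 ≤ 2 * t * ∫ x, truncSquare s h t x := by
  classical
  set U := {x | t < finSquare s h x} with hU
  have hUm : MeasurableSet U := measurableSet_level hh t
  have hUb := bddMeas_indicator_one hUm
  have hVb := bddMeas_indicator_one hUm.compl
  have hsq : ∀ R, Integrable fun x => h R x ^ 2 := fun R => by
    simpa only [sq] using (hh R).bddMeas.integrable_mul (hh R).integrable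
  have hR : ∀ R ∈ s.filter fun R => ¬ dyadicRectSet R ⊆ bigSet s h t,
      ∫ x, h R x ^ 2 ≤ 2 * ∫ x, h R x ^ 2 * Uᶜ.indicator (fun _ => 1) x := by
    intro R hR
    rw [Finset.mem_filter] at hR
    have h1 := integral_sq_indicator_level_le hh hR.1 hR.2
    have h2 : ∫ x, h R x ^ 2 = (∫ x, h R x ^ 2 * U.indicator (fun _ => 1) x) +
        ∫ x, h R x ^ 2 * Uᶜ.indicator (fun _ => 1) x := by
      rw [← integral_add (hUb.mul_integrable (hsq R)) (hVb.mul_integrable (hsq R))]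
      refine integral_congr_ae (.of_forall fun x => ?_)
      by_cases hx : x ∈ U <;> simp [hx]
    linarith
  unfold goodPart
  rw [integral_sum_sq hh]
  calc _ ≤ ∑ R ∈ s with ¬ dyadicRectSet R ⊆ bigSet s h t,
        2 * ∫ x, h R x ^ 2 * Uᶜ.indicator (fun _ => 1) x := Finset.sum_le_sum hR
    _ ≤ ∑ R ∈ s, 2 * ∫ x, h R x ^ 2 * Uᶜ.indicator (fun _ => 1) x := by
        refine Finset.sum_le_sum_of_subset_of_nonneg (Finset.filter_subset _ _) fun R _ _ => ?_
        exact mul_nonneg zero_le_two (integral_nonneg fun x => mul_nonneg (sq_nonneg _)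
          (Set.indicator_nonneg (fun _ _ => zero_le_one) x))
    _ = 2 * ∫ x, ∑ R ∈ s, h R x ^ 2 * Uᶜ.indicator (fun _ => 1) x := by
        rw [← Finset.mul_sum, integral_finsetSum _ fun R _ => hVb.mul_integrable (hsq R)]
    _ ≤ 2 * ∫ x, t * truncSquare s h t x := by
        refine mul_le_mul_of_nonneg_left (integral_mono
          (integrable_finsetSum _ fun R _ => hVb.mul_integrable (hsq R))
          ((integrable_truncSquare hh ht).const_mul t) fun x => ?_) zero_le_two
        simp only [← Finset.sum_mul, ← finSquare_sq]
        by_cases hx : x ∈ U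
        · simpa [hx] using mul_nonneg ht.le (truncSquare_nonneg ht.le x)
        · have hx' : finSquare s h x ≤ t := not_lt.1 hx
          have : finSquare s h x ^ 2 / t ≤ t := by
            rw [div_le_iff₀ ht, sq]
            exact mul_self_le_mul_self (finSquare_nonneg x) hx'
          simp only [Set.mem_compl_iff, hx, not_false_eq_true, Set.indicator_of_mem, mul_one,
            truncSquare, min_eq_right this]
          rw [mul_div_cancel₀ _ ht.ne']
    _ = _ := by rw [integral_const_mul]; ring

theorem integral_goodPart_mul {ψ : ProductSpace n → ℝ} {k : ℤ} (hh : ∀ R, IsHaar R (h R))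
    (ht : 0 < t) (hψ : BddMeas ψ) (hψi : ∀ i, BlockInv i k ψ)
    (hvol : volume.real (bigSet s h t) < ∏ i, (2 ^ k) ^ n i) :
    ∫ x, (∑ R ∈ s, h R x) * ψ x = ∫ x, goodPart s h t x * ψ x := by
  classical
  unfold goodPart
  simp only [Finset.sum_mul]
  rw [integral_finsetSum _ fun R _ => hψ.mul_integrable (hh R).integrable,
    integral_finsetSum _ fun R _ => hψ.mul_integrable (hh R).integrable, Finset.sum_filter]
  refine Finset.sum_congr rfl fun R _ => ?_
  split_ifs with hR
  swap
  · rfl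
  · have h1 := (measureReal_mono hR (volume_bigSet_ne_top hh ht)).trans_lt hvol
    rw [volume_real_dyadicRectSet] at h1
    obtain ⟨i, hi⟩ : ∃ i, (R i).k < k := by
      by_contra! hk
      refine h1.not_ge (Finset.prod_le_prod (fun i _ => by positivity) fun i _ => ?_)
      have := zpow_le_zpow_right₀ (one_le_two (α := ℝ)) (hk i)
      gcongr
    exact (hh R).integral_mul i ψ hψ ((hψi i).mono hi.le)

end Truncation

theorem min_le_telescope {r t : ℝ} (hr : 0 ≤ r) (ht : 0 < t) :
    min t (r ^ 2 / t) ≤ 6 * (r * (2 * t) / (r + 2 * t) - r * t / (r + t)) := by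
  have h1 : r * (2 * t) / (r + 2 * t) - r * t / (r + t) =
      r ^ 2 * t / ((r + 2 * t) * (r + t)) := by
    field_simp
    ring
  rw [h1, ← mul_div_assoc]
  rcases le_total t r with h | h
  · refine (min_le_left _ _).trans ?_
    rw [le_div_iff₀ (by positivity)]
    nlinarith [mul_nonneg ht.le (sub_nonneg.2 h), mul_nonneg ht.le (mul_nonneg hr (sub_nonneg.2 h)),
      mul_nonneg ht.le (mul_nonneg ht.le (sub_nonneg.2 h))]
  · refine (min_le_right _ _).trans ?_
    rw [div_le_div_iff₀ ht (by positivity)]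
    have : (r + 2 * t) * (r + t) ≤ 6 * t * t := by
      nlinarith [mul_nonneg hr (sub_nonneg.2 h), mul_nonneg ht.le (sub_nonneg.2 h)]
    nlinarith [mul_le_mul_of_nonneg_left this (sq_nonneg r)]

theorem sum_min_le {r : ℝ} (hr : 0 ≤ r) (a : ℤ) (N : ℕ) :
    ∑ j ∈ Finset.range N, min ((2 : ℝ) ^ (a + j)) (r ^ 2 / 2 ^ (a + j)) ≤ 6 * r := by
  set Φ : ℕ → ℝ := fun j => r * 2 ^ (a + j) / (r + 2 ^ (a + j)) with hΦ
  have hpos : ∀ j : ℕ, (0 : ℝ) < 2 ^ (a + j) := fun j => by positivity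
  calc _ ≤ ∑ j ∈ Finset.range N, 6 * (Φ (j + 1) - Φ j) := by
        refine Finset.sum_le_sum fun j _ => ?_
        have h2 : (2 : ℝ) ^ (a + ((j + 1 : ℕ) : ℤ)) = 2 * 2 ^ (a + j) := by
          rw [Nat.cast_succ, ← add_assoc, zpow_add_one₀ (by norm_num), mul_comm]
        simp only [hΦ, h2]
        exact min_le_telescope hr (hpos j)
    _ = 6 * (Φ N - Φ 0) := by rw [← Finset.mul_sum, Finset.sum_range_sub]
    _ ≤ 6 * r := by
        have h0 : 0 ≤ Φ 0 := by positivity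
        have h1 : Φ N ≤ r := by
          have := hpos N
          rw [hΦ, div_le_iff₀ (by positivity)]
          nlinarith
        linarith

theorem abs_le_half_add {t u : ℝ} (ht : 0 < t) : |u| ≤ t / 2 + u ^ 2 / (2 * t) := by
  rw [← sub_nonneg, ← sq_abs]
  have : t / 2 + |u| ^ 2 / (2 * t) - |u| = (t - |u|) ^ 2 / (2 * t) := by
    field_simp
    ring
  rw [this]
  positivity

section KeyInequality

variable {d : ℕ} {n : Fin d → ℕ} {s : Finset (DyadicRect n)}
  {h : DyadicRect n → ProductSpace n → ℝ} {t : ℝ}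

theorem sum_integral_truncSquare_le (hh : ∀ R, IsHaar R (h R)) (a : ℤ) (N : ℕ) :
    ∑ j ∈ Finset.range N, ∫ x, truncSquare s h (2 ^ (a + j)) x ≤ 6 * ∫ x, finSquare s h x := by
  have hi : ∀ j ∈ Finset.range N, Integrable (truncSquare s h (2 ^ (a + (j : ℕ)))) :=
    fun j _ => integrable_truncSquare hh (by positivity)
  rw [← integral_finsetSum _ hi, ← integral_const_mul]
  exact integral_mono (integrable_finsetSum _ hi) ((integrable_finSquare hh).const_mul 6)
    fun x => sum_min_le (finSquare_nonneg x) a N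

theorem integrable_goodPart_sq (hh : ∀ R, IsHaar R (h R)) (t : ℝ) :
    Integrable fun x => goodPart s h t x ^ 2 := by
  simpa only [sq] using (bddMeas_goodPart hh t).integrable_mul (integrable_goodPart hh t)

theorem integral_abs_goodPart_sub_le (hh : ∀ R, IsHaar R (h R)) (ht : 0 < t) :
    ∫ x, |goodPart s h (2 * t) x - goodPart s h t x| ≤
      (enlargeConst n + 1) * (∫ x, truncSquare s h t x) +
        2 * ∫ x, truncSquare s h (2 * t) x := by
  have hΩ := measurableSet_bigSet (s := s) hh t
  have hI : Integrable ((bigSet s h t).indicator fun _ => t) :=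
    (integrable_indicator_iff hΩ).2 (integrableOn_const (volume_bigSet_ne_top hh ht))
  have h1 := (integrable_goodPart_sq (s := s) hh t).div_const (2 * t)
  have h2 := (integrable_goodPart_sq (s := s) hh (2 * t)).div_const (2 * t)
  have h12 : Integrable fun x =>
      goodPart s h t x ^ 2 / (2 * t) + goodPart s h (2 * t) x ^ 2 / (2 * t) := h1.add h2
  have hpt : ∀ x, |goodPart s h (2 * t) x - goodPart s h t x| ≤
      (bigSet s h t).indicator (fun _ => t) x +
        (goodPart s h t x ^ 2 / (2 * t) + goodPart s h (2 * t) x ^ 2 / (2 * t)) := by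
    intro x
    by_cases hx : x ∈ bigSet s h t
    · simp only [hx, Set.indicator_of_mem]
      have := abs_le_half_add (u := goodPart s h t x) ht
      have := abs_le_half_add (u := goodPart s h (2 * t) x) ht
      have := abs_sub (goodPart s h (2 * t) x) (goodPart s h t x)
      linarith
    · rw [goodPart_eq hh hx, goodPart_eq hh fun h' => hx (bigSet_anti hh (by linarith) h')]
      simp only [sub_self, abs_zero, hx, not_false_eq_true, Set.indicator_of_notMem]
      positivity
  calc _ ≤ ∫ x, ((bigSet s h t).indicator (fun _ => t) x +
        (goodPart s h t x ^ 2 / (2 * t) + goodPart s h (2 * t) x ^ 2 / (2 * t))) :=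
        integral_mono ((integrable_goodPart hh _).sub (integrable_goodPart hh _)).abs
          (hI.add h12) hpt
    _ = t * volume.real (bigSet s h t) + ((∫ x, goodPart s h t x ^ 2) / (2 * t) +
        (∫ x, goodPart s h (2 * t) x ^ 2) / (2 * t)) := by
        rw [integral_add hI h12, integral_add h1 h2, integral_div, integral_div,
          integral_indicator hΩ, setIntegral_const, smul_eq_mul, mul_comm]
    _ ≤ enlargeConst n * (∫ x, truncSquare s h t x) + ((∫ x, truncSquare s h t x) +
        2 * ∫ x, truncSquare s h (2 * t) x) := by
        refine add_le_add (mul_volume_bigSet_le hh ht) (add_le_add ?_ ?_)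
        · rw [div_le_iff₀ (by positivity)]
          linarith [integral_goodPart_sq_le (s := s) hh ht]
        · rw [div_le_iff₀ (by positivity)]
          linarith [integral_goodPart_sq_le (s := s) (t := 2 * t) hh (by positivity)]
    _ = _ := by ring

theorem integral_abs_goodPart_le (hh : ∀ R, IsHaar R (h R)) (ht : 0 < t) :
    ∫ x, |goodPart s h t x| ≤ 2 * t * volume.real (⋃ R ∈ s, dyadicRectSet R) := by
  classical
  set W := ⋃ R ∈ s, dyadicRectSet R with hW
  have hWm : MeasurableSet W := s.measurableSet_biUnion fun R _ => measurableSet_dyadicRectSet R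
  have hWf : volume W ≠ ∞ := by
    refine (measure_biUnion_lt_top s.finite_toSet fun R _ => ?_).ne
    rw [volume_dyadicRectSet]
    exact ofReal_lt_top
  have hz : ∀ x ∉ W, ∀ R ∈ s, h R x = 0 := fun x hx R hR =>
    (hh R).eq_zero x fun h' => hx (Set.mem_biUnion hR h')
  have hI : ∀ c : ℝ, Integrable (W.indicator fun _ => c) := fun c =>
    (integrable_indicator_iff hWm).2 (integrableOn_const hWf)
  have hIi : ∀ c : ℝ, ∫ x, W.indicator (fun _ => c) x = c * volume.real W := fun c => by
    rw [integral_indicator hWm, setIntegral_const, smul_eq_mul, mul_comm]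
  have h1 : ∫ x, truncSquare s h t x ≤ t * volume.real W := by
    rw [← hIi]
    refine integral_mono (integrable_truncSquare hh ht) (hI t) fun x => ?_
    by_cases hx : x ∈ W
    · simp only [hx, Set.indicator_of_mem]
      exact min_le_left _ _
    · have : finSquare s h x ^ 2 = 0 := by
        rw [finSquare_sq]
        exact Finset.sum_eq_zero fun R hR => by simp [hz x hx R hR]
      simp [hx, truncSquare, this, ht.le]
  have h2 := (integrable_goodPart_sq (s := s) hh t).div_const (2 * t)
  calc _ ≤ ∫ x, (W.indicator (fun _ => t / 2) x + goodPart s h t x ^ 2 / (2 * t)) := by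
        refine integral_mono (integrable_goodPart hh _).abs ((hI _).add h2) fun x => ?_
        by_cases hx : x ∈ W
        · simpa [hx] using abs_le_half_add ht
        · have : goodPart s h t x = 0 := Finset.sum_eq_zero fun R hR =>
            hz x hx R (Finset.mem_filter.1 hR).1
          simp [hx, this]
    _ = t / 2 * volume.real W + (∫ x, goodPart s h t x ^ 2) / (2 * t) := by
        rw [integral_add (hI _) h2, hIi, integral_div]
    _ ≤ t * volume.real W + t * volume.real W := by
        gcongr
        · linarith
        · rw [div_le_iff₀ (by positivity)]
          have := integral_goodPart_sq_le (s := s) hh ht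
          nlinarith
    _ = _ := by ring

/-- The dyadic product `H¹` norm dominates the `L¹` norm, for finite sums. -/
theorem integral_abs_sum_le (hh : ∀ R, IsHaar R (h R)) (s : Finset (DyadicRect n)) :
    ∫ x, |∑ R ∈ s, h R x| ≤ 6 * (enlargeConst n + 3) * ∫ x, finSquare s h x := by
  set W := ⋃ R ∈ s, dyadicRectSet R with hW
  have hbound : ∀ a : ℤ, ∫ x, |∑ R ∈ s, h R x| ≤
      6 * (enlargeConst n + 3) * (∫ x, finSquare s h x) + 2 * 2 ^ a * volume.real W := by
    intro a
    obtain ⟨M, hM⟩ := (bddMeas_finSquare (s := s) hh).bdd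
    obtain ⟨N, hN⟩ := pow_unbounded_of_one_lt (M / 2 ^ a) (one_lt_two (α := ℝ))
    set u : ℕ → ProductSpace n → ℝ := fun j => goodPart s h (2 ^ (a + (j : ℤ))) with hu
    have hui : ∀ j, Integrable (u j) := fun j => integrable_goodPart hh _
    have huN : ∀ x, u N x = ∑ R ∈ s, h R x := by
      intro x
      refine goodPart_eq hh ?_
      have : {x | (2 : ℝ) ^ (a + (N : ℤ)) < finSquare s h x} = ∅ := by
        refine Set.eq_empty_of_forall_notMem fun y hy => ?_
        have hy' : (2 : ℝ) ^ (a + (N : ℤ)) < finSquare s h y := hy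
        rw [div_lt_iff₀ (by positivity)] at hN
        rw [zpow_add₀ (by norm_num), zpow_natCast, mul_comm] at hy'
        have := (le_abs_self _).trans (hM y)
        linarith
      rw [bigSet, this, enlargeList_empty (enlargeThreshold_pos n).le]
      exact Set.notMem_empty x
    have hstep : ∀ j, ∫ x, |u (j + 1) x - u j x| ≤
        (enlargeConst n + 1) * (∫ x, truncSquare s h (2 ^ (a + (j : ℤ))) x) +
          2 * ∫ x, truncSquare s h (2 ^ (a + 1 + (j : ℤ))) x := by
      intro j
      have e1 : (2 : ℝ) ^ (a + ((j + 1 : ℕ) : ℤ)) = 2 * 2 ^ (a + (j : ℤ)) := by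
        rw [Nat.cast_succ, ← add_assoc, zpow_add_one₀ (by norm_num), mul_comm]
      have e2 : (2 : ℝ) ^ (a + 1 + (j : ℤ)) = 2 * 2 ^ (a + (j : ℤ)) := by
        rw [add_right_comm, zpow_add_one₀ (by norm_num), mul_comm]
      simp only [hu, e1, e2]
      exact integral_abs_goodPart_sub_le hh (by positivity)
    have hpt : ∀ x, |∑ R ∈ s, h R x| ≤
        |u 0 x| + ∑ j ∈ Finset.range N, |u (j + 1) x - u j x| := by
      intro x
      have : ∑ R ∈ s, h R x = u 0 x + ∑ j ∈ Finset.range N, (u (j + 1) x - u j x) := by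
        rw [Finset.sum_range_sub (fun j => u j x), huN]
        ring
      rw [this]
      exact (abs_add_le _ _).trans (add_le_add le_rfl (Finset.abs_sum_le_sum_abs _ _))
    have hdi : ∀ j ∈ Finset.range N, Integrable fun x => |u (j + 1) x - u j x| :=
      fun j _ => ((hui _).sub (hui _)).abs
    calc _ ≤ ∫ x, (|u 0 x| + ∑ j ∈ Finset.range N, |u (j + 1) x - u j x|) :=
          integral_mono (integrable_finsetSum s fun R _ => (hh R).integrable).abs
            ((hui 0).abs.add (integrable_finsetSum _ hdi)) hpt
      _ = (∫ x, |u 0 x|) + ∑ j ∈ Finset.range N, ∫ x, |u (j + 1) x - u j x| := by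
          rw [integral_add (hui 0).abs (integrable_finsetSum _ hdi), integral_finsetSum _ hdi]
      _ ≤ 2 * 2 ^ a * volume.real W + ∑ j ∈ Finset.range N,
          ((enlargeConst n + 1) * (∫ x, truncSquare s h (2 ^ (a + (j : ℤ))) x) +
            2 * ∫ x, truncSquare s h (2 ^ (a + 1 + (j : ℤ))) x) := by
          refine add_le_add ?_ (Finset.sum_le_sum fun j _ => hstep j)
          have := integral_abs_goodPart_le (s := s) (t := 2 ^ a) hh (by positivity)
          simpa [hu] using this
      _ ≤ 2 * 2 ^ a * volume.real W + ((enlargeConst n + 1) * (6 * ∫ x, finSquare s h x) +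
          2 * (6 * ∫ x, finSquare s h x)) := by
          rw [Finset.sum_add_distrib, ← Finset.mul_sum, ← Finset.mul_sum]
          have := enlargeConst_nonneg n
          gcongr
          · exact sum_integral_truncSquare_le hh a N
          · exact sum_integral_truncSquare_le hh (a + 1) N
      _ = _ := by ring
  refine le_of_forall_pos_le_add fun ε hε => ?_
  obtain ⟨N, hN⟩ := exists_pow_lt_of_lt_one (show 0 < ε / (2 * (volume.real W + 1)) by positivity)
    (show (2⁻¹ : ℝ) < 1 by norm_num)
  refine (hbound (-N)).trans (add_le_add le_rfl ?_)
  rw [lt_div_iff₀ (by positivity)] at hN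
  rw [zpow_neg, zpow_natCast, ← inv_pow]
  have : (0 : ℝ) ≤ 2⁻¹ ^ N := by positivity
  linarith

end KeyInequality

section Uniqueness

variable {d : ℕ} {n : Fin d → ℕ} {i : Fin d} {k l : ℤ} {g φ : ProductSpace n → ℝ}

/-- The corners of the cubes of generation `k` containing the blocks of `x`. -/
noncomputable def gridCorner (k : ℤ) (x : ProductSpace n) : ProductSpace n :=
  fun i j => ⌊x i j / 2 ^ k⌋ * 2 ^ k

theorem dist_gridCorner_le (k : ℤ) (x : ProductSpace n) : dist (gridCorner k x) x ≤ 2 ^ k := by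
  have hk : (0 : ℝ) < 2 ^ k := by positivity
  refine (dist_pi_le_iff hk.le).2 fun i => (dist_pi_le_iff hk.le).2 fun j => ?_
  have h1 := Int.floor_le (x i j / 2 ^ k)
  have h2 := Int.lt_floor_add_one (x i j / 2 ^ k)
  rw [le_div_iff₀ hk] at h1
  rw [div_lt_iff₀ hk] at h2
  rw [Real.dist_eq, abs_le, gridCorner]
  constructor <;> linarith

theorem tendsto_gridCorner (x : ProductSpace n) :
    Tendsto (fun N : ℕ => gridCorner (-(N : ℤ)) x) atTop (nhds x) := by
  refine tendsto_iff_dist_tendsto_zero.2 (squeeze_zero (fun _ => dist_nonneg)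
    (fun N => dist_gridCorner_le _ x) ?_)
  simp only [zpow_neg, zpow_natCast, ← inv_pow]
  exact tendsto_pow_atTop_nhds_zero_of_lt_one (by norm_num) (by norm_num)

theorem blockInv_comp_gridCorner (φ : ProductSpace n → ℝ) (i : Fin d) (k : ℤ) :
    BlockInv i k fun x => φ (gridCorner k x) := by
  intro x y hxy
  rw [dyadicCubeOf_eq_iff] at hxy
  simp only
  congr 1
  funext a b
  by_cases h : a = i
  · subst h
    simp only [gridCorner, Function.update_self, hxy b]
  · simp only [gridCorner, Function.update_of_ne h]

theorem bddMeas_comp_gridCorner (hφ : Continuous φ) (hc : HasCompactSupport φ) (k : ℤ) :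
    BddMeas fun x => φ (gridCorner k x) := by
  obtain ⟨M, hM⟩ := hφ.bounded_above_of_compact_support hc
  exact ⟨measurable_of_blockInv fun i => blockInv_comp_gridCorner φ i k, M, fun x => hM _⟩

theorem exists_forall_comp_gridCorner_eq_zero (hc : HasCompactSupport φ) :
    ∃ r : ℝ, ∀ k ≤ 0, ∀ x, r < ‖x‖ → φ (gridCorner k x) = 0 := by
  obtain ⟨r, hr⟩ := hc.isCompact.isBounded.subset_closedBall (0 : ProductSpace n)
  refine ⟨r + 1, fun k hk x hx => ?_⟩
  by_contra hne
  have h1 := hr (subset_tsupport _ hne)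
  rw [mem_closedBall_zero_iff] at h1
  have h2 := dist_gridCorner_le k x
  have h3 : (2 : ℝ) ^ k ≤ 1 := zpow_le_one_of_nonpos₀ one_le_two hk
  rw [dist_comm, dist_eq_norm] at h2
  have h4 := norm_sub_norm_le x (gridCorner k x)
  linarith

theorem BddMeas.integrable_of_forall_eq_zero {α : Type*} [NormedAddCommGroup α] [ProperSpace α]
    [MeasurableSpace α] [BorelSpace α] {μ : Measure α} [IsFiniteMeasureOnCompacts μ] {H : α → ℝ}
    (hH : BddMeas H) {r : ℝ} (h : ∀ x, r < ‖x‖ → H x = 0) : Integrable H μ := by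
  have hi : Integrable ((Metric.closedBall (0 : α) r).indicator fun _ => (1 : ℝ)) μ :=
    (integrable_indicator_iff Metric.isClosed_closedBall.measurableSet).2
      (integrableOn_const (isCompact_closedBall _ _).measure_lt_top.ne)
  refine (hH.integrable_mul hi).congr (.of_forall fun x => ?_)
  by_cases hx : x ∈ Metric.closedBall (0 : α) r
  · simp [hx]
  · rw [mem_closedBall_zero_iff, not_le] at hx
    simp [h x hx]

theorem tendsto_integral_mul_of_tendsto {α : Type*} [MeasurableSpace α] {μ : Measure α} {M : ℝ}
    {g H : α → ℝ} {F : ℕ → α → ℝ} (hg : Integrable g μ) (hF : ∀ N, Measurable (F N))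
    (hM : ∀ N x, |F N x| ≤ M) (hlim : ∀ x, Tendsto (fun N => F N x) atTop (nhds (H x))) :
    Tendsto (fun N => ∫ x, g x * F N x ∂μ) atTop (nhds (∫ x, g x * H x ∂μ)) := by
  refine tendsto_integral_of_dominated_convergence (fun x => |g x| * M)
    (fun N => hg.aestronglyMeasurable.mul (hF N).aestronglyMeasurable) (hg.abs.mul_const M)
    (fun N => .of_forall fun x => ?_) (.of_forall fun x => (hlim x).const_mul _)
  rw [norm_mul]
  exact mul_le_mul_of_nonneg_left (hM N x) (norm_nonneg _)

theorem blockAvg_ae_eq_of_deltaBlock (h : ∀ Q, deltaBlock i Q g =ᵐ[volume] 0) (k : ℤ) (p : ℕ) :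
    blockAvg i k g =ᵐ[volume] blockAvg i (k + p) g := by
  have step : ∀ l, blockAvg i (l - 1) g =ᵐ[volume] blockAvg i l g := by
    intro l
    filter_upwards [eventually_countable_forall.2 h] with x hx
    have := hx (dyadicCubeOf l (x i))
    rw [deltaBlock_eq_mul, Set.indicator_of_mem (mem_dyadicCubeSet_dyadicCubeOf.2 rfl), one_mul]
      at this
    exact sub_eq_zero.1 this
  induction p with
  | zero => simp
  | succ p ih =>
    refine ih.trans ?_
    have := step (k + (p + 1 : ℕ))
    rw [Nat.cast_succ, ← add_assoc, add_sub_cancel_right] at this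
    rw [Nat.cast_succ, ← add_assoc]
    exact this

theorem ae_eq_zero_of_deltaBlock (hn : 1 ≤ n i) (hg : Integrable g)
    (h : ∀ Q, deltaBlock i Q g =ᵐ[volume] 0) : g =ᵐ[volume] 0 := by
  refine ae_eq_zero_of_integral_contDiff_smul_eq_zero hg.locallyIntegrable fun φ hφ hc => ?_
  simp only [smul_eq_mul, mul_comm (φ _)]
  obtain ⟨M, hM⟩ := hφ.continuous.bounded_above_of_compact_support hc
  obtain ⟨r, hr⟩ := exists_forall_comp_gridCorner_eq_zero hc
  have hz : ∀ N : ℕ, ∫ x, g x * φ (gridCorner (-(N : ℤ)) x) = 0 := by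
    intro N
    set k : ℤ := -(N : ℤ) with hk
    have hb := bddMeas_comp_gridCorner hφ.continuous hc k
    set ψ : ProductSpace n → ℝ := fun x => φ (gridCorner k x) with hψ
    have e : ∀ p : ℕ, ∫ x, g x * ψ x = ∫ x, g x * blockAvg i (k + p) ψ x := by
      intro p
      have e' : ∫ x, blockAvg i (k + p) g x * ψ x = ∫ x, blockAvg i k g x * ψ x :=
        integral_congr_ae (by
          filter_upwards [blockAvg_ae_eq_of_deltaBlock h k p] with x hx
          rw [hx])
      rw [← integral_blockAvg_mul hg hb, e', integral_blockAvg_mul hg hb,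
        blockAvg_eq_self (blockInv_comp_gridCorner φ i k)]
    have hlim : ∀ x, Tendsto (fun p : ℕ => blockAvg i (k + p) ψ x) atTop (nhds 0) := by
      intro x
      have hi : Integrable fun y => ψ (Function.update x i y) := by
        refine (hb.comp (measurable_update_block i x)).integrable_of_forall_eq_zero (r := r)
          fun y hy => hr k (by lia) _ (hy.trans_le ?_)
        simpa using norm_le_pi_norm (Function.update x i y) i
      refine squeeze_zero_norm (a := fun p : ℕ => ((2 ^ (k + p)) ^ n i)⁻¹ *
        ∫ y, |ψ (Function.update x i y)|) (fun p => ?_) ?_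
      · rw [blockAvg_eq_integral, ← integral_const_mul]
        refine (norm_integral_le_integral_norm _).trans (integral_mono
          (hb.integrable_cubeKernel_mul x i _).norm (hi.abs.const_mul _) fun y => ?_)
        simp only [norm_mul, Real.norm_of_nonneg (cubeKernel_nonneg _ _ _)]
        exact mul_le_mul_of_nonneg_right (cubeKernel_le _ _ _) (abs_nonneg _)
      · rw [← zero_mul (∫ y, |ψ (Function.update x i y)|)]
        refine Tendsto.mul_const _ (tendsto_inv_atTop_zero.comp
          ((tendsto_pow_atTop (by lia)).comp ?_))
        simp only [zpow_add₀ (two_ne_zero (α := ℝ)), zpow_natCast]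
        exact (tendsto_pow_atTop_atTop_of_one_lt _root_.one_lt_two).const_mul_atTop (by positivity)
    have := tendsto_integral_mul_of_tendsto hg
      (fun p : ℕ => (hb.blockAvg i (k + p)).measurable)
      (fun p x => abs_blockAvg_le hb (fun x => hM _) x) hlim
    simp only [← e, mul_zero, integral_zero] at this
    exact tendsto_nhds_unique tendsto_const_nhds this
  have := tendsto_integral_mul_of_tendsto hg
    (fun N : ℕ => (bddMeas_comp_gridCorner hφ.continuous hc (-(N : ℤ))).measurable)
    (fun N x => hM _) (fun x => (hφ.continuous.tendsto x).comp (tendsto_gridCorner x))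
  simp only [hz] at this
  exact tendsto_nhds_unique this tendsto_const_nhds

theorem deltaList_congr {l : List (Fin d)} {R R' : DyadicRect n} (h : ∀ j ∈ l, R j = R' j) :
    deltaList l R g = deltaList l R' g := by
  induction l with
  | nil => simp only [deltaList, List.foldr_nil]
  | cons j l ih =>
    have e := ih fun a ha => h a (List.mem_cons_of_mem _ ha)
    rw [deltaList_cons, deltaList_cons, e]
    exact congrArg (fun c => deltaBlock j c (deltaList l R' g)) (h j List.mem_cons_self)

theorem ae_eq_zero_of_deltaList (hn : ∀ i, 1 ≤ n i) (hg : Integrable g) {l : List (Fin d)}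
    (hl : l.Nodup) (h : ∀ R, deltaList l R g =ᵐ[volume] 0) : g =ᵐ[volume] 0 := by
  induction l with
  | nil => exact h fun i => ⟨0, 0⟩
  | cons i l ih =>
    rw [List.nodup_cons] at hl
    refine ih hl.2 fun R => ae_eq_zero_of_deltaBlock (hn i) (hg.deltaList l) fun Q => ?_
    have := h (Function.update R i Q)
    rwa [deltaList_cons, Function.update_self, deltaList_congr (R' := R) fun j hj => ?_] at this
    exact Function.update_of_ne (fun e => hl.1 (by rwa [e] at hj)) _ _

end Uniqueness

section Density

variable {d : ℕ} {n : Fin d → ℕ} {i : Fin d} {R R' : DyadicRect n} {f g h H : ProductSpace n → ℝ}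

theorem exists_integral_deltaList_mul_eq (l : List (Fin d)) (R : DyadicRect n) (hH : BddMeas H) :
    ∃ H', BddMeas H' ∧
      ∀ g, Integrable g → ∫ x, deltaList l R g x * H x = ∫ x, g x * H' x := by
  induction l generalizing H with
  | nil => exact ⟨H, hH, fun g _ => by simp only [deltaList, List.foldr_nil]⟩
  | cons i l ih =>
    obtain ⟨H', hb, he⟩ := ih (hH.deltaBlock (R i))
    refine ⟨H', hb, fun g hg => ?_⟩
    rw [deltaList_cons, integral_deltaBlock_mul (hg.deltaList l) hH, he g hg]

theorem IsHaar.integral_mul_deltaBlock (hh : IsHaar R h) (hH : BddMeas H) :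
    ∫ x, h x * deltaBlock i (R i) H x = ∫ x, h x * H x := by
  have e : ∀ x, h x * deltaBlock i (R i) H x =
      h x * blockAvg i ((R i).k - 1) H x - h x * blockAvg i (R i).k H x := by
    intro x
    rw [deltaBlock_eq_mul]
    by_cases hx : x ∈ dyadicRectSet R
    · rw [Set.indicator_of_mem (hx i), one_mul, mul_sub]
    · simp [hh.eq_zero x hx]
  simp only [e]
  rw [integral_sub ((hH.blockAvg i _).mul_integrable hh.integrable)
      ((hH.blockAvg i _).mul_integrable hh.integrable),
    hh.integral_mul i _ (hH.blockAvg i _) blockInv_blockAvg, sub_zero,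
    ← integral_blockAvg_mul hh.integrable hH, blockAvg_eq_self (hh.blockInv i)]

theorem IsHaar.integral_mul_deltaBlock_eq_zero (hh : IsHaar R h) (hH : BddMeas H)
    {c : DyadicCube (n i)} (hc : c ≠ R i) : ∫ x, h x * deltaBlock i c H x = 0 := by
  rcases lt_trichotomy (R i).k c.k with hk | hk | hk
  · exact hh.integral_mul i _ (hH.deltaBlock c) ((blockInv_deltaBlock c).mono (by lia))
  · refine integral_eq_zero_of_ae (.of_forall fun x => ?_)
    by_cases hx : x ∈ dyadicRectSet R
    · by_cases hx' : x i ∈ dyadicCubeSet c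
      · rw [mem_dyadicRectSet_iff] at hx
        rw [mem_dyadicCubeSet_iff] at hx'
        exact absurd (hx'.symm.trans (hk ▸ hx i)) hc
      · simp [deltaBlock_eq_mul, hx']
    · simp [hh.eq_zero x hx]
  · rw [← integral_deltaBlock_mul hh.integrable hH, deltaBlock_eq_zero c
      ((hh.blockInv i).mono (by lia))]
    simp

theorem IsHaar.integral_deltaList_mul (hh : IsHaar R h) (hH : BddMeas H) {l : List (Fin d)}
    (hl : ∀ i ∈ l, R' i = R i) : ∫ x, deltaList l R' h x * H x = ∫ x, h x * H x := by
  induction l generalizing H with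
  | nil => simp only [deltaList, List.foldr_nil]
  | cons i l ih =>
    rw [deltaList_cons, integral_deltaBlock_mul (hh.integrable.deltaList l) hH,
      ih (hH.deltaBlock _) fun j hj => hl j (List.mem_cons_of_mem _ hj),
      hl i List.mem_cons_self, hh.integral_mul_deltaBlock hH]

theorem IsHaar.integral_deltaList_mul_eq_zero (hh : IsHaar R h) (hH : BddMeas H)
    {l : List (Fin d)} (hl : ∃ i ∈ l, R' i ≠ R i) : ∫ x, deltaList l R' h x * H x = 0 := by
  induction l generalizing H with
  | nil => simp at hl
  | cons i l ih =>
    rw [deltaList_cons, integral_deltaBlock_mul (hh.integrable.deltaList l) hH]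
    by_cases h' : ∃ j ∈ l, R' j ≠ R j
    · exact ih (hH.deltaBlock _) h'
    · push Not at h'
      rw [hh.integral_deltaList_mul (hH.deltaBlock _) h']
      obtain ⟨j, hj, hne⟩ := hl
      rcases List.mem_cons.1 hj with rfl | hj
      · exact hh.integral_mul_deltaBlock_eq_zero hH hne
      · exact absurd (h' j hj) hne

theorem ofReal_finSquare_le (s t : Finset (DyadicRect n)) (hst : Disjoint t s)
    (h : DyadicRect n → ProductSpace n → ℝ) (x : ProductSpace n) :
    ENNReal.ofReal (finSquare t h x) ≤
      (∑' R : {R // R ∉ s}, ENNReal.ofReal (h R x ^ 2)) ^ (1 / 2 : ℝ) := by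
  have e : ENNReal.ofReal (finSquare t h x) =
      (∑ R ∈ t, ENNReal.ofReal (h R x ^ 2)) ^ (1 / 2 : ℝ) := by
    rw [← ENNReal.ofReal_sum_of_nonneg fun _ _ => sq_nonneg _, ← finSquare_sq,
      ENNReal.ofReal_rpow_of_nonneg (sq_nonneg _) (by norm_num), ← Real.sqrt_eq_rpow,
      Real.sqrt_sq (finSquare_nonneg x)]
  rw [e]
  classical
  refine ENNReal.rpow_le_rpow ?_ (by norm_num)
  have hmem : ∀ R ∈ t, R ∉ s := fun R hR hs => Finset.disjoint_left.1 hst hR hs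
  rw [← Finset.sum_subtype_of_mem (fun R => ENNReal.ofReal (h R x ^ 2)) hmem]
  exact ENNReal.sum_le_tsum _

theorem ofReal_finSquare_le_squareFn (s : Finset (DyadicRect n)) (x : ProductSpace n) :
    ENNReal.ofReal (finSquare s (fun R => deltaR R f) x) ≤ squareFn f x := by
  refine (ofReal_finSquare_le ∅ s (Finset.disjoint_empty_right s) _ x).trans
    (ENNReal.rpow_le_rpow ?_ (by norm_num))
  exact ENNReal.tsum_comp_le_tsum_of_injective Subtype.val_injective
    fun R => ENNReal.ofReal (deltaR R f x ^ 2)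

theorem integral_finSquare_le_one (hf : Integrable f) (hS : H1Norm f ≤ 1)
    (s : Finset (DyadicRect n)) : ∫ x, finSquare s (fun R => deltaR R f) x ≤ 1 := by
  rw [integral_eq_lintegral_of_nonneg_ae (.of_forall fun x => finSquare_nonneg x)
    (integrable_finSquare fun R => isHaar_deltaR hf R).aestronglyMeasurable]
  refine ENNReal.toReal_le_of_le_ofReal zero_le_one ?_
  rw [ENNReal.ofReal_one]
  exact (lintegral_mono fun x => ofReal_finSquare_le_squareFn s x).trans hS

theorem exists_forall_disjoint_integral_finSquare_lt {h : DyadicRect n → ProductSpace n → ℝ}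
    (hh : ∀ R, IsHaar R (h R))
    (hS : ∫⁻ x, (∑' R, ENNReal.ofReal (h R x ^ 2)) ^ (1 / 2 : ℝ) ≠ ⊤) {ε : ℝ} (hε : 0 < ε) :
    ∃ s : Finset (DyadicRect n), ∀ t, Disjoint t s → ∫ x, finSquare t h x < ε := by
  have hm' : ∀ R, Measurable fun x => ENNReal.ofReal (h R x ^ 2) := fun R =>
    ((hh R).bddMeas.measurable.pow_const 2).ennreal_ofReal
  have hlim : Tendsto (fun s : Finset (DyadicRect n) =>
      ∫⁻ x, (∑' R : {R // R ∉ s}, ENNReal.ofReal (h R x ^ 2)) ^ (1 / 2 : ℝ)) atTop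
      (nhds (∫⁻ _ : ProductSpace n, 0)) := by
    refine tendsto_lintegral_filter_of_dominated_convergence
      (fun x => (∑' R, ENNReal.ofReal (h R x ^ 2)) ^ (1 / 2 : ℝ))
      (.of_forall fun s => (Measurable.tsum fun R : {R // R ∉ s} => hm' R).pow_const _)
      (.of_forall fun s => .of_forall fun x => ENNReal.rpow_le_rpow
        (ENNReal.tsum_comp_le_tsum_of_injective Subtype.val_injective
          fun R => ENNReal.ofReal (h R x ^ 2)) (by norm_num)) hS ?_
    filter_upwards [ae_lt_top ((Measurable.tsum hm').pow_const _) hS] with x hx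
    have hx' : ∑' R, ENNReal.ofReal (h R x ^ 2) ≠ ⊤ := by
      intro e
      rw [e, ENNReal.top_rpow_of_pos (by norm_num)] at hx
      exact lt_irrefl _ hx
    have := (ENNReal.continuous_rpow_const (y := (1 / 2 : ℝ))).tendsto 0
    rw [ENNReal.zero_rpow_of_pos (by norm_num)] at this
    exact this.comp (ENNReal.tendsto_tsum_compl_atTop_zero hx')
  rw [lintegral_zero] at hlim
  obtain ⟨s, hs⟩ := (hlim.eventually_lt_const (ENNReal.ofReal_pos.2 hε)).exists
  refine ⟨s, fun t ht => ?_⟩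
  have hle := (lintegral_mono fun x => ofReal_finSquare_le s t ht h x).trans_lt hs
  rw [integral_eq_lintegral_of_nonneg_ae (.of_forall fun x => finSquare_nonneg x)
    (integrable_finSquare hh).aestronglyMeasurable]
  exact (ENNReal.lt_ofReal_iff_toReal_lt (hle.trans ENNReal.ofReal_lt_top).ne).1 hle

theorem toL1_sum {α ι : Type*} [MeasurableSpace α] {μ : Measure α} {u : ι → α → ℝ}
    (hu : ∀ i, Integrable (u i) μ) (s : Finset ι) :
    ∑ i ∈ s, (hu i).toL1 (u i) =
      (integrable_finsetSum s fun i _ => hu i).toL1 (fun x => ∑ i ∈ s, u i x) := by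
  classical
  induction s using Finset.induction_on with
  | empty => simp only [Finset.sum_empty]; rfl
  | insert a s ha ih =>
    simp only [Finset.sum_insert ha, ih]
    rw [← Integrable.toL1_add]
    rfl

theorem exists_tendsto_integral_abs_sub {α ι : Type*} [MeasurableSpace α] {μ : Measure α}
    {u : ι → α → ℝ} (hu : ∀ i, Integrable (u i) μ)
    (hsum : ∀ ε > 0, ∃ s : Finset ι, ∀ t, Disjoint t s → ∫ x, |∑ i ∈ t, u i x| ∂μ < ε) :
    ∃ G, Integrable G μ ∧
      Tendsto (fun s : Finset ι => ∫ x, |G x - ∑ i ∈ s, u i x| ∂μ) atTop (nhds 0) := by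
  have hs : Summable fun i => (hu i).toL1 (u i) := by
    refine summable_iff_vanishing_norm.2 fun ε hε => ?_
    obtain ⟨s, hs⟩ := hsum ε hε
    refine ⟨s, fun t ht => ?_⟩
    rw [toL1_sum, L1.norm_eq_integral_norm]
    refine lt_of_eq_of_lt (integral_congr_ae ?_) (hs t ht)
    filter_upwards [Integrable.coeFn_toL1 (integrable_finsetSum t fun i _ => hu i)] with x hx
    rw [hx, Real.norm_eq_abs]
  set G : α →₁[μ] ℝ := ∑' i, (hu i).toL1 (u i) with hG
  refine ⟨G, L1.integrable_coeFn G, ?_⟩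
  refine (tendsto_iff_norm_sub_tendsto_zero.1 hs.hasSum).congr fun s => ?_
  rw [norm_sub_rev, toL1_sum, L1.norm_eq_integral_norm]
  refine integral_congr_ae ?_
  filter_upwards [Integrable.coeFn_toL1 (integrable_finsetSum s fun i _ => hu i),
    Lp.coeFn_sub G ((integrable_finsetSum s fun i _ => hu i).toL1 _)] with x hx hx'
  rw [hx', Pi.sub_apply, hx, Real.norm_eq_abs]

theorem ae_eq_zero_of_integral_mul {α : Type*} [MeasurableSpace α] {μ : Measure α} {g : α → ℝ}
    (hg : Integrable g μ) (h : ∀ H, BddMeas H → ∫ x, g x * H x ∂μ = 0) : g =ᵐ[μ] 0 := by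
  refine hg.ae_eq_zero_of_forall_setIntegral_eq_zero fun s hs _ => ?_
  rw [← integral_indicator hs, ← h _ (bddMeas_indicator_one hs)]
  congr 1
  ext x
  by_cases hx : x ∈ s <;> simp [hx]

theorem exists_integral_abs_sub_sum_deltaR_le (hn : ∀ i, 1 ≤ n i) (hf : Integrable f)
    (hS : H1Norm f ≠ ⊤) {ε : ℝ} (hε : 0 < ε) :
    ∃ s : Finset (DyadicRect n), ∫ x, |f x - ∑ R ∈ s, deltaR R f x| ≤ ε := by
  have hh : ∀ R, IsHaar R (deltaR R f) := isHaar_deltaR hf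
  have hC : 0 < 6 * (enlargeConst n + 3) := by have := enlargeConst_nonneg n; positivity
  obtain ⟨G, hG, hlim⟩ := exists_tendsto_integral_abs_sub (fun R => (hh R).integrable)
    fun δ hδ => by
      obtain ⟨s, hs⟩ := exists_forall_disjoint_integral_finSquare_lt hh hS (div_pos hδ hC)
      refine ⟨s, fun t ht => (integral_abs_sum_le hh t).trans_lt ?_⟩
      rw [mul_comm, ← lt_div_iff₀ hC]
      exact hs t ht
  have hsumi : ∀ s : Finset (DyadicRect n), Integrable fun x => ∑ R ∈ s, deltaR R f x :=
    fun s => integrable_finsetSum s fun R _ => (hh R).integrable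
  have key : ∀ R' H, BddMeas H →
      ∫ x, deltaR R' (fun x => G x - f x) x * H x = 0 := by
    intro R' H hH
    obtain ⟨H', hH', he⟩ := exists_integral_deltaList_mul_eq (List.finRange d) R' hH
    simp only [← deltaR_eq_deltaList] at he
    have h1 : Tendsto (fun s : Finset (DyadicRect n) =>
        ∫ x, (∑ R ∈ s, deltaR R f x) * H' x) atTop (nhds (∫ x, G x * H' x)) := by
      obtain ⟨M, hM⟩ := hH'.bdd
      rw [tendsto_iff_norm_sub_tendsto_zero]
      refine squeeze_zero (fun _ => norm_nonneg _) (fun s => ?_)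
        (by simpa using hlim.mul_const M)
      rw [← integral_sub (hH'.mul_integrable (hsumi s)) (hH'.mul_integrable hG),
        ← integral_mul_const]
      refine (norm_integral_le_integral_norm _).trans (integral_mono
        ((hH'.mul_integrable (hsumi s)).sub (hH'.mul_integrable hG)).norm
        ((hG.sub (hsumi s)).abs.mul_const M) fun x => ?_)
      simp only [← sub_mul, norm_mul, Real.norm_eq_abs]
      rw [abs_sub_comm]
      exact mul_le_mul_of_nonneg_left (hM x) (abs_nonneg _)
    have h2 : ∀ᶠ s : Finset (DyadicRect n) in atTop,
        ∫ x, (∑ R ∈ s, deltaR R f x) * H' x = ∫ x, f x * H' x := by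
      filter_upwards [eventually_ge_atTop {R'}] with s hs
      simp only [Finset.sum_mul]
      rw [integral_finsetSum s fun R _ => hH'.mul_integrable (hh R).integrable,
        Finset.sum_eq_single_of_mem R' (hs (Finset.mem_singleton_self _)), ← he _ (hh R').integrable,
        deltaR_eq_deltaList R' (deltaR R' f), (hh R').integral_deltaList_mul hH fun _ _ => rfl,
        he f hf]
      intro R _ hR
      obtain ⟨i, hi⟩ := Function.ne_iff.1 hR
      rw [← he _ (hh R).integrable, deltaR_eq_deltaList R' (deltaR R f)]
      exact (hh R).integral_deltaList_mul_eq_zero hH ⟨i, List.mem_finRange i, hi.symm⟩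
    have h3 := tendsto_nhds_unique h1 (tendsto_const_nhds.congr' (h2.mono fun s hs => hs.symm))
    rw [he (fun x => G x - f x) (hG.sub hf)]
    simp only [sub_mul]
    rw [integral_sub (hH'.mul_integrable hG) (hH'.mul_integrable hf), h3, sub_self]
  have hGf : (fun x => G x - f x) =ᵐ[volume] 0 :=
    ae_eq_zero_of_deltaList hn (hG.sub hf) (List.nodup_finRange d) fun R =>
      ae_eq_zero_of_integral_mul ((hG.sub hf).deltaList _) fun H hH => by
        rw [← deltaR_eq_deltaList]; exact key R H hH
  obtain ⟨s, hs⟩ := (hlim.eventually_lt_const hε).exists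
  refine ⟨s, le_of_eq_of_le (integral_congr_ae ?_) hs.le⟩
  filter_upwards [hGf] with x hx
  rw [sub_eq_zero.1 hx]

end Density

section JonesJourne

variable {d : ℕ} {n : Fin d → ℕ} {t : ℝ}

theorem abs_sub_le_of_truncation {g v F T Q : ℝ} (hQ : 0 < Q) (h : g = F) :
    |g - v| ≤ Q⁻¹ * g ^ 2 + max (|v| - T) 0 + min |F - v| (T + Q) := by
  subst h
  have h0 : 0 ≤ Q⁻¹ * g ^ 2 := by positivity
  have h1 := le_max_left (|v| - T) 0
  have h2 := le_max_right (|v| - T) 0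
  rcases le_total |g - v| (T + Q) with h' | h'
  · rw [min_eq_left h']
    linarith
  · rw [min_eq_right h']
    have h3 : |g - v| ≤ |g| + |v| := abs_sub _ _
    have h4 : |g| ≤ Q + Q⁻¹ * g ^ 2 := by
      rcases le_total |g| Q with hg | hg
      · linarith
      · have : |g| ≤ Q⁻¹ * g ^ 2 := by
          rw [← sq_abs, le_inv_mul_iff₀ hQ, sq]
          exact mul_le_mul_of_nonneg_right hg (abs_nonneg _)
        linarith
    linarith

variable {s : Finset (DyadicRect n)} {h : DyadicRect n → ProductSpace n → ℝ}
  {v ψ : ProductSpace n → ℝ} {T Q M : ℝ} {k : ℤ}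

theorem abs_integral_sum_mul_sub_le (hh : ∀ R, IsHaar R (h R)) (ht : 0 < t) (hT : 0 ≤ T)
    (hQ : 0 < Q) (hv : Integrable v) (hψ : BddMeas ψ) (hM : ∀ x, |ψ x| ≤ M)
    (hψ' : Integrable ψ) (hψi : ∀ i, BlockInv i k ψ)
    (hvol : volume.real (bigSet s h t) < ∏ i, (2 ^ k) ^ n i) :
    |(∫ x, (∑ R ∈ s, h R x) * ψ x) - ∫ x, v x * ψ x| ≤
      M * ((t / 2 + T) * volume.real (bigSet s h t) +
        ((2 * t)⁻¹ + Q⁻¹) * (∫ x, goodPart s h t x ^ 2) + ∫ x, max (|v x| - T) 0) +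
      ∫ x, |ψ x| * min |(∑ R ∈ s, h R x) - v x| (T + Q) := by
  set E := bigSet s h t with hE
  have hEm : MeasurableSet E := measurableSet_bigSet hh t
  have i1 : Integrable (E.indicator fun _ => t / 2 + T) :=
    (integrable_indicator_iff hEm).2 (integrableOn_const (volume_bigSet_ne_top hh ht))
  have i2 := (integrable_goodPart_sq (s := s) hh t).const_mul ((2 * t)⁻¹ + Q⁻¹)
  have i3 : Integrable fun x => max (|v x| - T) 0 := by
    refine hv.abs.mono ((hv.abs.aestronglyMeasurable.sub aestronglyMeasurable_const).sup
      aestronglyMeasurable_const) (.of_forall fun x => ?_)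
    rw [Real.norm_of_nonneg (le_max_right _ _), Real.norm_of_nonneg (abs_nonneg _)]
    exact max_le (by linarith) (abs_nonneg _)
  have hFi : Integrable fun x => ∑ R ∈ s, h R x :=
    integrable_finsetSum s fun R _ => (hh R).integrable
  have i4 : Integrable fun x => |ψ x| * min |(∑ R ∈ s, h R x) - v x| (T + Q) := by
    refine (hψ'.abs.mul_const (T + Q)).mono (hψ'.abs.aestronglyMeasurable.mul
      ((hFi.sub hv).abs.aestronglyMeasurable.inf aestronglyMeasurable_const))
      (.of_forall fun x => ?_)
    rw [Real.norm_of_nonneg (mul_nonneg (abs_nonneg _) (le_min (abs_nonneg _) (by positivity))),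
      Real.norm_of_nonneg (mul_nonneg (abs_nonneg _) (by positivity))]
    exact mul_le_mul_of_nonneg_left (min_le_right _ _) (abs_nonneg _)
  have hgi := integrable_goodPart (s := s) hh t
  have hpt : ∀ x, |(goodPart s h t x - v x) * ψ x| ≤
      M * (E.indicator (fun _ => t / 2 + T) x + ((2 * t)⁻¹ + Q⁻¹) * goodPart s h t x ^ 2 +
        max (|v x| - T) 0) + |ψ x| * min |(∑ R ∈ s, h R x) - v x| (T + Q) := by
    intro x
    set m := min |(∑ R ∈ s, h R x) - v x| (T + Q) with hm
    set A := E.indicator (fun _ => t / 2 + T) x + ((2 * t)⁻¹ + Q⁻¹) * goodPart s h t x ^ 2 +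
        max (|v x| - T) 0 with hA
    have hA0 : 0 ≤ A := by
      have : 0 ≤ E.indicator (fun _ => t / 2 + T) x :=
        Set.indicator_nonneg (fun _ _ => by positivity) x
      have := le_max_right (|v x| - T) 0
      positivity
    have key : |goodPart s h t x - v x| ≤ A + m := by
      by_cases hx : x ∈ E
      · have h1 := abs_le_half_add (u := goodPart s h t x) ht
        have h2 : |goodPart s h t x - v x| ≤ |goodPart s h t x| + |v x| := abs_sub _ _
        have h3 := le_max_left (|v x| - T) 0
        have h4 : 0 ≤ m := le_min (abs_nonneg _) (by positivity)
        have h5 : 0 ≤ Q⁻¹ * goodPart s h t x ^ 2 := by positivity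
        rw [hA, Set.indicator_of_mem hx]
        rw [div_eq_inv_mul (_ ^ 2)] at h1
        linarith
      · have h1 := abs_sub_le_of_truncation (v := v x) (T := T) hQ (goodPart_eq hh hx)
        have h2 : 0 ≤ (2 * t)⁻¹ * goodPart s h t x ^ 2 := by positivity
        rw [hA, Set.indicator_of_notMem hx]
        linarith
    rw [abs_mul, mul_comm]
    calc |ψ x| * |goodPart s h t x - v x| ≤ |ψ x| * (A + m) :=
          mul_le_mul_of_nonneg_left key (abs_nonneg _)
      _ = |ψ x| * A + |ψ x| * m := mul_add _ _ _
      _ ≤ _ := by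
          gcongr
          exact hM x
  rw [integral_goodPart_mul hh ht hψ hψi hvol,
    ← integral_sub (hψ.mul_integrable hgi) (hψ.mul_integrable hv)]
  simp only [← sub_mul]
  have e1 : ∫ x, E.indicator (fun _ => t / 2 + T) x = (t / 2 + T) * volume.real E := by
    rw [integral_indicator hEm, setIntegral_const, smul_eq_mul, mul_comm]
  have i5 : Integrable fun x => E.indicator (fun _ => t / 2 + T) x +
      ((2 * t)⁻¹ + Q⁻¹) * goodPart s h t x ^ 2 := i1.add i2
  have i6 : Integrable fun x => M * (E.indicator (fun _ => t / 2 + T) x +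
      ((2 * t)⁻¹ + Q⁻¹) * goodPart s h t x ^ 2 + max (|v x| - T) 0) := (i5.add i3).const_mul M
  rw [← e1, ← integral_const_mul ((2 * t)⁻¹ + Q⁻¹), ← integral_add i1 i2, ← integral_add i5 i3,
    ← integral_const_mul M, ← integral_add i6 i4]
  refine (abs_integral_le_integral_abs).trans (integral_mono
    (hψ.mul_integrable (hgi.sub hv)).abs (i6.add i4) hpt)

theorem exists_integral_max_sub_le (hv : Integrable v) {η : ℝ} (hη : 0 < η) :
    ∃ T, 0 ≤ T ∧ ∫ x, max (|v x| - T) 0 ≤ η := by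
  have hlim : Tendsto (fun T : ℕ => ∫ x, max (|v x| - T) 0) atTop
      (nhds (∫ _ : ProductSpace n, (0 : ℝ))) := by
    refine tendsto_integral_of_dominated_convergence (fun x => |v x|) (fun T =>
      (hv.abs.aestronglyMeasurable.sub aestronglyMeasurable_const).sup
      aestronglyMeasurable_const) hv.abs (fun T => .of_forall fun x => ?_) (.of_forall fun x => ?_)
    · rw [Real.norm_of_nonneg (le_max_right _ _)]
      exact max_le (by linarith [Nat.cast_nonneg (α := ℝ) T]) (abs_nonneg _)
    · obtain ⟨T₀, hT₀⟩ := exists_nat_ge |v x|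
      refine tendsto_const_nhds.congr' ?_
      filter_upwards [eventually_ge_atTop T₀] with T hT
      rw [max_eq_right]
      have : (T₀ : ℝ) ≤ T := by exact_mod_cast hT
      linarith
  rw [integral_zero] at hlim
  obtain ⟨T, hT⟩ := (hlim.eventually_lt_const hη).exists
  exact ⟨T, Nat.cast_nonneg T, hT.le⟩

theorem exists_integral_truncSquare_le (hh : ∀ R, IsHaar R (h R))
    (hS : ∫ x, finSquare s h x ≤ 1) (J : ℤ) {N : ℕ} (hN : 0 < N) :
    ∃ j < N, ∫ x, truncSquare s h (2 ^ (J + j)) x ≤ 6 / N := by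
  by_contra! hc
  have h1 := sum_integral_truncSquare_le (s := s) hh J N
  have h2 : ∑ j ∈ Finset.range N, (6 / N : ℝ) <
      ∑ j ∈ Finset.range N, ∫ x, truncSquare s h (2 ^ (J + j)) x :=
    Finset.sum_lt_sum_of_nonempty (Finset.nonempty_range_iff.2 hN.ne')
      fun j hj => hc j (Finset.mem_range.1 hj)
  rw [Finset.sum_const, Finset.card_range, nsmul_eq_mul, mul_div_cancel₀ _ (by positivity)] at h2
  linarith

theorem tendsto_integral_sum_mul_of_blockInv {s : ℕ → Finset (DyadicRect n)}
    {h : ℕ → DyadicRect n → ProductSpace n → ℝ} (hh : ∀ m R, IsHaar R (h m R))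
    (hS : ∀ m, ∫ x, finSquare (s m) (h m) x ≤ 1) (hv : Integrable v)
    (hlim : ∀ᵐ x, Tendsto (fun m => ∑ R ∈ s m, h m R x) atTop (nhds (v x)))
    (hψ : BddMeas ψ) (hψ' : Integrable ψ) (hψi : ∀ i, BlockInv i k ψ) :
    Tendsto (fun m => ∫ x, (∑ R ∈ s m, h m R x) * ψ x) atTop (nhds (∫ x, v x * ψ x)) := by
  obtain ⟨M, hM⟩ := hψ.bdd
  have hM0 : 0 ≤ M := (abs_nonneg _).trans (hM 0)
  set D := enlargeConst n with hD
  have hD0 : 0 ≤ D := enlargeConst_nonneg n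
  rw [Metric.tendsto_atTop']
  intro ε hε
  set η := ε / (2 * (2 * M + 1)) with hη
  have hη0 : 0 < η := by positivity
  obtain ⟨T, hT, hTv⟩ := exists_integral_max_sub_le hv hη0
  set c : ℝ := ∏ i, ((2 : ℝ) ^ k) ^ n i with hc
  have hc0 : 0 < c := Finset.prod_pos fun i _ => by positivity
  obtain ⟨J, hJ⟩ := pow_unbounded_of_one_lt (max T (D / c)) _root_.one_lt_two
  obtain ⟨N, hN⟩ := exists_nat_gt ((3 / 2 * D + 3) * 6 / η)
  have hN0 : (0 : ℝ) < N := lt_of_le_of_lt (by positivity) hN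
  set Q : ℝ := 2 ^ (J + N) with hQ
  have hQ0 : 0 < Q := by positivity
  have hmin : Tendsto (fun m => ∫ x, |ψ x| * min |(∑ R ∈ s m, h m R x) - v x| (T + Q)) atTop
      (nhds (∫ _ : ProductSpace n, (0 : ℝ))) := by
    refine tendsto_integral_of_dominated_convergence (fun x => |ψ x| * (T + Q)) (fun m =>
      hψ'.abs.aestronglyMeasurable.mul ((((integrable_finsetSum (s m) fun R _ =>
        (hh m R).integrable).sub hv).abs.aestronglyMeasurable).inf aestronglyMeasurable_const))
      (hψ'.abs.mul_const _) (fun m => .of_forall fun x => ?_) ?_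
    · rw [Real.norm_of_nonneg (mul_nonneg (abs_nonneg _) (le_min (abs_nonneg _) (by positivity)))]
      exact mul_le_mul_of_nonneg_left (min_le_right _ _) (abs_nonneg _)
    · filter_upwards [hlim] with x hx
      have h1 := ((tendsto_iff_norm_sub_tendsto_zero.1 hx).min
        (tendsto_const_nhds (x := T + Q))).const_mul |ψ x|
      rwa [min_eq_left (by positivity), mul_zero] at h1
  rw [integral_zero] at hmin
  obtain ⟨m₀, hm₀⟩ := (hmin.eventually_lt_const hη0).exists_forall_of_atTop
  refine ⟨m₀, fun m hm => ?_⟩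
  obtain ⟨j, hj, ha⟩ := exists_integral_truncSquare_le (s := s m) (hh m) (hS m) J (N := N)
    (by exact_mod_cast hN0)
  set t : ℝ := 2 ^ ((J : ℤ) + j) with ht
  have ht0 : 0 < t := by positivity
  have htJ : (2 : ℝ) ^ J ≤ t := by
    rw [ht, ← zpow_natCast]
    exact zpow_le_zpow_right₀ (by norm_num) (by lia)
  have htQ : t ≤ Q := by
    rw [ht, hQ, ← zpow_natCast]
    exact zpow_le_zpow_right₀ (by norm_num) (by push_cast; lia)
  have htT : T ≤ t := (le_max_left _ _).trans (hJ.le.trans htJ)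
  set a := ∫ x, truncSquare (s m) (h m) t x with ha'
  have ha0 : 0 ≤ a := integral_nonneg fun x => truncSquare_nonneg ht0.le x
  have ha1 : a ≤ 1 := (integral_mono (integrable_truncSquare (hh m) ht0)
    (integrable_finSquare (hh m)) fun x => truncSquare_le ht0 x).trans (hS m)
  have hvol := mul_volume_bigSet_le (s := s m) (hh m) ht0
  have hsq := integral_goodPart_sq_le (s := s m) (hh m) ht0
  rw [← ha'] at hvol hsq
  have hvol' : volume.real (bigSet (s m) (h m) t) < c := by
    have h1 : D / c < t := (le_max_right _ _).trans_lt (hJ.trans_le htJ)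
    rw [div_lt_iff₀ hc0] at h1
    refine lt_of_mul_lt_mul_left (hvol.trans_lt (lt_of_le_of_lt ?_ h1)) ht0.le
    exact mul_le_of_le_one_right hD0 ha1
  have main := abs_integral_sum_mul_sub_le (hh m) ht0 hT hQ0 hv hψ hM hψ' hψi hvol'
  rw [Real.dist_eq]
  have b1 : (t / 2 + T) * volume.real (bigSet (s m) (h m) t) ≤ 3 / 2 * D * a := by
    calc _ ≤ (t / 2 + t) * volume.real (bigSet (s m) (h m) t) := by gcongr
      _ = 3 / 2 * (t * volume.real (bigSet (s m) (h m) t)) := by ring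
      _ ≤ 3 / 2 * (D * a) := by gcongr
      _ = _ := by ring
  have b2 : ((2 * t)⁻¹ + Q⁻¹) * (∫ x, goodPart (s m) (h m) t x ^ 2) ≤ 3 * a := by
    have hQt : Q⁻¹ ≤ t⁻¹ := inv_anti₀ ht0 htQ
    calc _ ≤ ((2 * t)⁻¹ + t⁻¹) * (2 * t * a) := by gcongr
      _ = 3 * a := by field_simp; ring
  have b3 : 3 / 2 * D * a + 3 * a ≤ η := by
    have h1 : (3 / 2 * D + 3) * a ≤ (3 / 2 * D + 3) * (6 / N) := by gcongr
    have h2 : (3 / 2 * D + 3) * (6 / N) ≤ η := by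
      rw [← mul_div_assoc, div_le_iff₀ hN0, mul_comm η]
      exact ((div_lt_iff₀ hη0).1 hN).le
    linarith
  have b4 : M * ((t / 2 + T) * volume.real (bigSet (s m) (h m) t) +
      ((2 * t)⁻¹ + Q⁻¹) * (∫ x, goodPart (s m) (h m) t x ^ 2) + ∫ x, max (|v x| - T) 0) ≤
      M * (2 * η) := mul_le_mul_of_nonneg_left (by linarith) hM0
  have b5 := hm₀ m hm.le
  have b6 : M * (2 * η) + η = ε / 2 := by
    rw [hη]
    field_simp
  linarith

theorem tendsto_integral_sum_mul {s : ℕ → Finset (DyadicRect n)}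
    {h : ℕ → DyadicRect n → ProductSpace n → ℝ} (hh : ∀ m R, IsHaar R (h m R))
    (hS : ∀ m, ∫ x, finSquare (s m) (h m) x ≤ 1) (hv : Integrable v)
    (hlim : ∀ᵐ x, Tendsto (fun m => ∑ R ∈ s m, h m R x) atTop (nhds (v x)))
    {φ : ProductSpace n → ℝ} (hφ : Continuous φ) (hc : HasCompactSupport φ) :
    Tendsto (fun m => ∫ x, (∑ R ∈ s m, h m R x) * φ x) atTop (nhds (∫ x, v x * φ x)) := by
  set C := 6 * (enlargeConst n + 3) with hC
  have hC0 : 0 < C := by have := enlargeConst_nonneg n; positivity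
  have hFi : ∀ m, Integrable fun x => ∑ R ∈ s m, h m R x := fun m =>
    integrable_finsetSum (s m) fun R _ => (hh m R).integrable
  have hF : ∀ m, ∫ x, |∑ R ∈ s m, h m R x| ≤ C := fun m =>
    (integral_abs_sum_le (hh m) (s m)).trans (mul_le_of_le_one_right hC0.le (hS m))
  have hφb : BddMeas φ := ⟨hφ.measurable, hφ.bounded_above_of_compact_support hc⟩
  set V := ∫ x, |v x| with hV
  have hV0 : 0 ≤ V := integral_nonneg fun x => abs_nonneg _
  rw [Metric.tendsto_atTop']
  intro ε hε
  set η := ε / (2 * (C + V)) with hη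
  have hη0 : 0 < η := by positivity
  obtain ⟨δ, hδ, hφδ⟩ := Metric.uniformContinuous_iff.1
    (hc.uniformContinuous_of_continuous hφ) η hη0
  obtain ⟨K, hK⟩ := exists_pow_lt_of_lt_one hδ (show (2⁻¹ : ℝ) < 1 by norm_num)
  set ψ : ProductSpace n → ℝ := fun x => φ (gridCorner (-(K : ℤ)) x) with hψdef
  have hψ : BddMeas ψ := bddMeas_comp_gridCorner hφ hc _
  obtain ⟨r, hr⟩ := exists_forall_comp_gridCorner_eq_zero hc
  have hψ' : Integrable ψ := hψ.integrable_of_forall_eq_zero fun x => hr _ (by lia) x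
  have hdiff : ∀ x, |φ x - ψ x| ≤ η := fun x => by
    have h1 := dist_gridCorner_le (-(K : ℤ)) x
    rw [zpow_neg, zpow_natCast, ← inv_pow] at h1
    have h2 := hφδ (h1.trans_lt hK)
    rw [dist_comm, Real.dist_eq] at h2
    exact h2.le
  have approx : ∀ g : ProductSpace n → ℝ, Integrable g →
      |(∫ x, g x * φ x) - ∫ x, g x * ψ x| ≤ η * ∫ x, |g x| := by
    intro g hg
    rw [← integral_sub (hφb.mul_integrable hg) (hψ.mul_integrable hg), ← integral_const_mul]
    refine abs_integral_le_integral_abs.trans (integral_mono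
      ((hφb.mul_integrable hg).sub (hψ.mul_integrable hg)).abs (hg.abs.const_mul _) fun x => ?_)
    simp only [← mul_sub, abs_mul]
    rw [mul_comm]
    exact mul_le_mul_of_nonneg_right (hdiff x) (abs_nonneg _)
  have hψlim := tendsto_integral_sum_mul_of_blockInv hh hS hv hlim hψ hψ'
    fun i => blockInv_comp_gridCorner φ i _
  obtain ⟨m₀, hm₀⟩ := Metric.tendsto_atTop'.1 hψlim (ε / 2) (half_pos hε)
  refine ⟨m₀, fun m hm => ?_⟩
  have h1 := hm₀ m hm
  have h2 := (approx _ (hFi m)).trans (mul_le_mul_of_nonneg_left (hF m) hη0.le)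
  have h3 := approx v hv
  have h4 : η * C + η * V = ε / 2 := by
    rw [hη]
    field_simp
  rw [Real.dist_eq] at h1 ⊢
  rw [abs_le] at h2 h3
  rw [abs_lt] at h1 ⊢
  constructor <;> linarith

theorem ae_tendsto_sub_of_integral_abs_sub_le {α : Type*} [MeasurableSpace α] {μ : Measure α}
    {f F : ℕ → α → ℝ} {v : α → ℝ} (hf : ∀ m, Integrable (f m) μ) (hF : ∀ m, Integrable (F m) μ)
    (h : ∀ m, ∫ x, |f m x - F m x| ∂μ ≤ (1 / 2) ^ m)
    (hlim : ∀ᵐ x ∂μ, Tendsto (fun m => f m x) atTop (nhds (v x))) :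
    ∀ᵐ x ∂μ, Tendsto (fun m => F m x) atTop (nhds (v x)) := by
  have hm : ∀ m, AEMeasurable (fun x => ENNReal.ofReal |f m x - F m x|) μ := fun m =>
    ((hf m).sub (hF m)).abs.aestronglyMeasurable.aemeasurable.ennreal_ofReal
  have hfin : ∫⁻ x, ∑' m, ENNReal.ofReal |f m x - F m x| ∂μ ≠ ⊤ := by
    rw [lintegral_tsum hm]
    have hle : ∀ m, ∫⁻ x, ENNReal.ofReal |f m x - F m x| ∂μ ≤ ENNReal.ofReal ((1 / 2) ^ m) :=
      fun m => by
        rw [← ofReal_integral_eq_lintegral_ofReal (f := fun x => |f m x - F m x|)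
          ((hf m).sub (hF m)).abs (.of_forall fun x => abs_nonneg _)]
        exact ENNReal.ofReal_le_ofReal (h m)
    refine ne_top_of_le_ne_top ?_ (ENNReal.tsum_le_tsum hle)
    rw [← ENNReal.ofReal_tsum_of_nonneg (fun m => by positivity) summable_geometric_two]
    exact ENNReal.ofReal_ne_top
  filter_upwards [ae_lt_top' (AEMeasurable.tsum hm) hfin, hlim] with x hx hfx
  have h1 := (ENNReal.tendsto_toReal ENNReal.zero_ne_top).comp
    (ENNReal.tendsto_atTop_zero_of_tsum_ne_top hx.ne)
  have h2 : Tendsto (fun m => f m x - F m x) atTop (nhds 0) := by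
    refine (tendsto_zero_iff_abs_tendsto_zero _).2 (h1.congr fun m => ?_)
    simp
  simpa using hfx.sub h2

theorem integrable_of_ae_tendsto_of_integral_abs_le {α : Type*} [MeasurableSpace α]
    {μ : Measure α} {F : ℕ → α → ℝ} {v : α → ℝ} {C : ℝ} (hF : ∀ m, Integrable (F m) μ)
    (hC : ∀ m, ∫ x, |F m x| ∂μ ≤ C)
    (hlim : ∀ᵐ x ∂μ, Tendsto (fun m => F m x) atTop (nhds (v x))) : Integrable v μ := by
  refine ⟨aestronglyMeasurable_of_tendsto_ae _ (fun m => (hF m).aestronglyMeasurable) hlim, ?_⟩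
  have h1 : ∫⁻ x, ‖v x‖ₑ ∂μ ≤ liminf (fun m => ∫⁻ x, ‖F m x‖ₑ ∂μ) atTop := by
    refine le_of_eq_of_le (lintegral_congr_ae ?_)
      (lintegral_liminf_le' fun m => (hF m).aestronglyMeasurable.aemeasurable.enorm)
    filter_upwards [hlim] with x hx using hx.enorm.liminf_eq.symm
  refine (h1.trans (liminf_le_of_frequently_le' (.of_forall fun m => ?_))).trans_lt
    (ENNReal.ofReal_lt_top (r := C))
  simp only [← ofReal_norm, Real.norm_eq_abs]
  rw [← ofReal_integral_eq_lintegral_ofReal (hF m).abs (.of_forall fun x => abs_nonneg _)]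
  exact ENNReal.ofReal_le_ofReal (hC m)

end JonesJourne

/-- Jones–Journé in the multiparameter setting, tested on `C_c^∞`:
if `‖S f_m‖_{L¹} ≤ 1` for all `m` and `f_m → f` a.e., then `f ∈ L¹` and
`∫ f_m φ → ∫ f φ` for every `φ ∈ C_c^∞`. -/
theorem statement0 {d : ℕ} (hd : 1 ≤ d) (n : Fin d → ℕ) (hn : ∀ i, 1 ≤ n i)
    (f : ℕ → ProductSpace n → ℝ) (flim : ProductSpace n → ℝ)
    (hL1 : ∀ m, Integrable (f m))
    (hH1 : ∀ m, H1Norm (f m) ≤ 1)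
    (hae : ∀ᵐ x ∂(volume : Measure (ProductSpace n)),
      Tendsto (fun m => f m x) atTop (nhds (flim x))) :
    Integrable flim ∧
      ∀ φ : ProductSpace n → ℝ, ContDiff ℝ (⊤ : ℕ∞) φ → HasCompactSupport φ →
        Tendsto (fun m => ∫ x, f m x * φ x) atTop (nhds (∫ x, flim x * φ x)) := by
  have hh : ∀ m R, IsHaar R (deltaR R (f m)) := fun m R => isHaar_deltaR (hL1 m) R
  choose s hs using fun m => exists_integral_abs_sub_sum_deltaR_le hn (hL1 m)
    (ne_top_of_le_ne_top ENNReal.one_ne_top (hH1 m)) (pow_pos (one_half_pos (α := ℝ)) m)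
  have hS := fun m => integral_finSquare_le_one (hL1 m) (hH1 m) (s m)
  have hF : ∀ m, Integrable fun x => ∑ R ∈ s m, deltaR R (f m) x := fun m =>
    integrable_finsetSum (s m) fun R _ => (hh m R).integrable
  have hFlim := ae_tendsto_sub_of_integral_abs_sub_le hL1 hF hs hae
  have hC0 : 0 ≤ 6 * (enlargeConst n + 3) := by
    have := enlargeConst_nonneg n
    positivity
  have hlim := integrable_of_ae_tendsto_of_integral_abs_le hF
    (fun m => (integral_abs_sum_le (hh m) (s m)).trans (mul_le_of_le_one_right hC0 (hS m))) hFlim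
  refine ⟨hlim, fun φ hφ hc => ?_⟩
  have h1 := tendsto_integral_sum_mul hh hS hlim hFlim hφ.continuous hc
  obtain ⟨M, hM⟩ := hφ.continuous.bounded_above_of_compact_support hc
  have hφb : BddMeas φ := ⟨hφ.continuous.measurable, M, hM⟩
  have h2 : Tendsto (fun m => (∫ x, f m x * φ x) - ∫ x, (∑ R ∈ s m, deltaR R (f m) x) * φ x)
      atTop (nhds 0) := by
    refine squeeze_zero_norm (a := fun m : ℕ => (1 / 2 : ℝ) ^ m * M) (fun m => ?_) (by
      simpa using (tendsto_pow_atTop_nhds_zero_of_lt_one (by norm_num)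
        (show (1 / 2 : ℝ) < 1 by norm_num)).mul_const M)
    have hM0 : 0 ≤ M := (norm_nonneg _).trans (hM 0)
    rw [← integral_sub (hφb.mul_integrable (hL1 m)) (hφb.mul_integrable (hF m))]
    refine (norm_integral_le_integral_norm _).trans (le_trans ?_
      (mul_le_mul_of_nonneg_right (hs m) hM0))
    rw [← integral_mul_const]
    refine integral_mono ((hφb.mul_integrable (hL1 m)).sub (hφb.mul_integrable (hF m))).norm
      (((hL1 m).sub (hF m)).abs.mul_const M) fun x => ?_
    simp only [← sub_mul, norm_mul]
    exact mul_le_mul_of_nonneg_left (hM x) (norm_nonneg _)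
  simpa using h2.add h1
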